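/- arXiv:2203.02763 — 8 statements merged into one kernel-verified Lean document; each statement's English description precedes it below -/
import Mathlib

section
/- There is an absolute constant C > 0 such that for every δ ∈ (0, 1/2], every standard Zeno walk (Z_i) with parameter δ, and every index i ≥ 0, almost surely |E[Y_{i+1} − Y_i | F_i]| ≤ C·δ², where Y_i := ln(1/(1 − Z_i)). -/
open MeasureTheory ProbabilityTheory

/-- A Zeno walk in `(lam - eps, lam + eps)` with parameter `del`:
a process `Z` adapted to a filtration `F`, with `F i`-measurable step sizes
`d i ∈ [0, del]`, starting at `lam`, whose increment at time `i` is
`± (eps - |Z i - lam|) * d i`, the sign being a fair coin flip independent of `F i`. -/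
structure ZenoWalk {Ω : Type*} [mΩ : MeasurableSpace Ω] (μ : Measure Ω)
    (lam eps del : ℝ) where
  F : Filtration ℕ mΩ
  Z : ℕ → Ω → ℝ
  d : ℕ → Ω → ℝ
  xi : ℕ → Ω → ℝ
  meas_Z : ∀ i, Measurable[F i] (Z i)
  meas_d : ∀ i, Measurable[F i] (d i)
  meas_xi : ∀ i, Measurable[F (i + 1)] (xi i)
  d_mem : ∀ i, ∀ᵐ ω ∂μ, d i ω ∈ Set.Icc 0 del
  Z_zero : ∀ᵐ ω ∂μ, Z 0 ω = lam
  step : ∀ i, ∀ᵐ ω ∂μ,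
    Z (i + 1) ω = Z i ω + xi i ω * ((eps - |Z i ω - lam|) * d i ω)
  xi_indep : ∀ i,
    ProbabilityTheory.Indep (MeasurableSpace.comap (xi i) inferInstance) (F i) μ
  xi_plus : ∀ i, μ {ω | xi i ω = 1} = 1 / 2
  xi_minus : ∀ i, μ {ω | xi i ω = -1} = 1 / 2

lemma log_aux (x : ℝ) (h1 : -(1/2) ≤ x) (h2 : x ≤ 1/2) :
    |-Real.log (1 - x) - x| ≤ 2 * x ^ 2 := by
  have hp : 0 < 1 - x := by linarith
  have a := Real.log_le_sub_one_of_pos hp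
  have b := Real.one_sub_inv_le_log_of_pos hp
  have c : (1 - x)⁻¹ ≤ 1 + x + 2 * x ^ 2 := by
    rw [inv_le_iff_one_le_mul₀ hp]
    nlinarith [mul_nonneg (sq_nonneg x) (by linarith : 0 ≤ 1 - 2 * x)]
  rw [abs_le]
  constructor <;> nlinarith [sq_nonneg x]

lemma xi_ae {Ω : Type} [mΩ : MeasurableSpace Ω] (μ : Measure Ω) [IsProbabilityMeasure μ]
    (x : Ω → ℝ) (hx : Measurable x) (hp : μ {ω | x ω = 1} = 1 / 2)
    (hm : μ {ω | x ω = -1} = 1 / 2) :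
    (∀ᵐ ω ∂μ, x ω = 1 ∨ x ω = -1) ∧ ∫ ω, x ω ∂μ = 0 := by
  have m1 : MeasurableSet {ω | x ω = 1} := hx (measurableSet_singleton 1)
  have m2 : MeasurableSet {ω | x ω = -1} := hx (measurableSet_singleton (-1))
  have key : ∀ᵐ ω ∂μ, x ω = 1 ∨ x ω = -1 := by
    have hd : Disjoint {ω | x ω = 1} {ω | x ω = -1} := by
      rw [Set.disjoint_left]
      intro ω h h'
      simp only [Set.mem_setOf_eq] at h h'
      linarith
    have h1 : μ ({ω | x ω = 1} ∪ {ω | x ω = -1}) = 1 := by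
      rw [measure_union hd m2, hp, hm, ENNReal.add_halves]
    have := (prob_compl_eq_zero_iff (m1.union m2)).2 h1
    exact this
  refine ⟨key, ?_⟩
  have e : x =ᵐ[μ] fun ω => Set.indicator {ω | x ω = 1} (fun _ => (1:ℝ)) ω
      - Set.indicator {ω | x ω = -1} (fun _ => (1:ℝ)) ω := by
    filter_upwards [key] with ω h
    rcases h with h | h <;> simp [Set.indicator, h] <;> norm_num
  rw [integral_congr_ae e, integral_sub, integral_indicator_const _ m1,
    integral_indicator_const _ m2, Measure.real, Measure.real, hp, hm]
  · simp
  · exact (integrable_const _).indicator m1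
  · exact (integrable_const _).indicator m2

lemma Z_abs {Ω : Type} [mΩ : MeasurableSpace Ω] (μ : Measure Ω) [IsProbabilityMeasure μ]
    (del : ℝ) (hdel : del ≤ 1 / 2) (W : ZenoWalk μ 0 1 del) (i : ℕ) :
    ∀ᵐ ω ∂μ, |W.Z i ω| < 1 := by
  induction i with
  | zero =>
    filter_upwards [W.Z_zero] with ω h
    simp [h]
  | succ i ih =>
    filter_upwards [ih, W.step i, W.d_mem i, (xi_ae μ (W.xi i)
      ((W.meas_xi i).mono (W.F.le _) le_rfl) (W.xi_plus i) (W.xi_minus i)).1] with ω h hs hd hx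
    rw [hs, sub_zero]
    have hd2 := hd.2
    have hd1 := hd.1
    have hb : |W.xi i ω * ((1 - |W.Z i ω|) * W.d i ω)| < 1 - |W.Z i ω| := by
      have : |W.xi i ω| = 1 := by rcases hx with h | h <;> simp [h]
      rw [abs_mul, this, one_mul, abs_mul, abs_of_pos (by linarith), abs_of_nonneg hd1]
      nlinarith
    have := abs_add_le (W.Z i ω) (W.xi i ω * ((1 - |W.Z i ω|) * W.d i ω))
    linarith

theorem statement1 :
    ∃ C : ℝ, 0 < C ∧
      ∀ {Ω : Type} [mΩ : MeasurableSpace Ω] (μ : Measure Ω),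
        IsProbabilityMeasure μ →
        ∀ del : ℝ, del ∈ Set.Ioc (0 : ℝ) (1 / 2) →
        ∀ W : ZenoWalk μ 0 1 del, ∀ i : ℕ,
        ∀ᵐ ω ∂μ,
          |(μ[(fun ω' => Real.log (1 / (1 - W.Z (i + 1) ω'))
              - Real.log (1 / (1 - W.Z i ω'))) | W.F i]) ω|
            ≤ C * del ^ 2 := by
  refine ⟨2, by norm_num, ?_⟩
  intro Ω mΩ μ hμ del hdel W i
  have mxi : Measurable (W.xi i) := (W.meas_xi i).mono (W.F.le _) le_rfl
  have mZ : ∀ j, Measurable (W.Z j) := fun j => (W.meas_Z j).mono (W.F.le _) le_rfl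
  obtain ⟨hxi, hint⟩ := xi_ae μ (W.xi i) mxi (W.xi_plus i) (W.xi_minus i)
  have hZ := Z_abs μ del hdel.2 W i
  set u : Ω → ℝ := fun ω => (1 - |W.Z i ω|) * W.d i ω / (1 - W.Z i ω) with hu
  have mu : Measurable[W.F i] u := by
    have h1 := W.meas_Z i
    have h2 := W.meas_d i
    have h3 : Measurable[W.F i] (fun ω => |W.Z i ω|) := measurable_abs.comp h1
    exact ((measurable_const.sub h3).mul h2).div (measurable_const.sub h1)
  have mu' : Measurable u := mu.mono (W.F.le _) le_rfl
  have bu : ∀ᵐ ω ∂μ, 0 ≤ u ω ∧ u ω ≤ del := by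
    filter_upwards [hZ, W.d_mem i] with ω h hd
    have hd1 := hd.1
    have hd2 := hd.2
    have := le_abs_self (W.Z i ω)
    have hp : 0 < 1 - W.Z i ω := by linarith
    have hq : 0 < 1 - |W.Z i ω| := by linarith
    refine ⟨by positivity, ?_⟩
    simp only [hu]
    rw [div_le_iff₀ hp]
    nlinarith
  set f : Ω → ℝ := fun ω' => Real.log (1 / (1 - W.Z (i + 1) ω'))
              - Real.log (1 / (1 - W.Z i ω')) with hf
  have mf : Measurable f := by
    have h1 := mZ i
    have h2 := mZ (i+1)
    fun_prop
  set g : Ω → ℝ := u * W.xi i with hg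
  have mg : Measurable g := mu'.mul mxi
  have bg : ∀ᵐ ω ∂μ, |g ω| ≤ del := by
    filter_upwards [bu, hxi] with ω h hx
    have : |W.xi i ω| = 1 := by rcases hx with h | h <;> simp [h]
    simp only [hg, Pi.mul_apply]
    rw [abs_mul, this, mul_one, abs_of_nonneg h.1]
    exact h.2
  have bR : ∀ᵐ ω ∂μ, |(f - g) ω| ≤ 2 * del ^ 2 := by
    filter_upwards [bg, hZ, W.step i] with ω h hz hs
    have h' := abs_le.1 h
    have hd2 := hdel.2
    have hl := log_aux (g ω) (by linarith) (by linarith)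
    have hzz := le_abs_self (W.Z i ω)
    have hp : 0 < 1 - W.Z i ω := by linarith
    have e : 1 - W.Z (i+1) ω = (1 - W.Z i ω) * (1 - g ω) := by
      rw [hs]
      simp only [hg, hu, Pi.mul_apply, sub_zero]
      field_simp
      ring
    have e2 : f ω = - Real.log (1 - g ω) := by
      simp only [hf]
      rw [e, one_div, one_div, Real.log_inv, Real.log_inv, Real.log_mul hp.ne' (by linarith)]
      ring
    rw [Pi.sub_apply, e2]
    refine hl.trans ?_
    have := sq_le_sq' h'.1 h'.2
    linarith
  have ig : Integrable g μ := Integrable.of_bound mg.aestronglyMeasurable del bg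
  have iR : Integrable (f - g) μ :=
    Integrable.of_bound (mf.sub mg).aestronglyMeasurable (2 * del ^ 2) bR
  have ixi : Integrable (W.xi i) μ := by
    refine Integrable.of_bound mxi.aestronglyMeasurable 1 ?_
    filter_upwards [hxi] with ω h
    rcases h with h | h <;> simp [h]
  have c1 : μ[g | W.F i] =ᵐ[μ] u * μ[W.xi i | W.F i] :=
    condExp_mul_of_stronglyMeasurable_left mu.stronglyMeasurable ig ixi
  have c2 : μ[W.xi i | W.F i] =ᵐ[μ] fun _ => ∫ ω, W.xi i ω ∂μ :=
    condExp_indep_eq mxi.comap_le (W.F.le i)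
      (comap_measurable (W.xi i)).stronglyMeasurable (W.xi_indep i)
  have c3 : μ[f | W.F i] =ᵐ[μ] μ[f - g | W.F i] + μ[g | W.F i] := by
    have := condExp_add iR ig (W.F i)
    rwa [sub_add_cancel] at this
  have c4 : ∀ᵐ ω ∂μ, |(μ[f - g | W.F i]) ω| ≤ 2 * del ^ 2 := by
    have := ae_bdd_condExp_of_ae_bdd (m := W.F i) (R := ⟨2 * del ^ 2, by positivity⟩) bR
    exact this
  filter_upwards [c1, c2, c3, c4] with ω h1 h2 h3 h4
  rw [h3, Pi.add_apply, h1, Pi.mul_apply, h2, hint, mul_zero, add_zero]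
  exact h4
end

section
/- There are absolute constants C, c > 0 such that for every δ ∈ (0, 1/2], every standard Zeno walk (Z_i) with parameter δ, every index i ≥ 1, and every real k ≥ 1: P[Y_i ≥ δ·k·√i + C·i·δ²] ≤ exp(−c·k²), where Y_i := ln(1/(1 − Z_i)). -/
open MeasureTheory ProbabilityTheory

lemma zw_log (s : ℝ) (hs : |s| ≤ 1 / 2) : -Real.log (1 - s) ≤ s + 2 * s ^ 2 := by
  have h := Real.abs_log_sub_add_sum_range_le (x := s) (by linarith) 1
  simp at h
  have h2 : s ^ 2 / (1 - |s|) ≤ 2 * s ^ 2 := by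
    rw [div_le_iff₀ (by linarith)]
    nlinarith [sq_nonneg s]
  have := neg_le_of_abs_le h
  linarith

lemma zw_step (z x d e : ℝ) (hz : |z| < 1) (hd : 0 ≤ d) (hd2 : d ≤ e) (he : e ≤ 1 / 2)
    (hx : x = (1 - |z|) / (1 - z) * d) (s : ℝ) (hs : s = 1 ∨ s = -1) :
    0 ≤ x ∧ x ≤ e ∧ |z + s * ((1 - |z|) * d)| < 1 ∧
    Real.log (1 / (1 - (z + s * ((1 - |z|) * d)))) ≤
      Real.log (1 / (1 - z)) + s * x + 2 * e ^ 2 := by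
  have hz1 : 0 < 1 - z := by linarith [le_abs_self z]
  have hr0 : 0 ≤ (1 - |z|) / (1 - z) := div_nonneg (by linarith) hz1.le
  have hr1 : (1 - |z|) / (1 - z) ≤ 1 := by
    rw [div_le_one hz1]; linarith [le_abs_self z]
  have hx0 : 0 ≤ x := by rw [hx]; positivity
  have hx1 : x ≤ e := by rw [hx]; nlinarith
  have habs : |s * x| = x := by
    rcases hs with rfl | rfl <;> simp [abs_of_nonneg hx0]
  have hsx : |s * x| ≤ 1 / 2 := by linarith
  have hfac : 1 - (z + s * ((1 - |z|) * d)) = (1 - z) * (1 - s * x) := by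
    rw [hx]; field_simp; ring
  refine ⟨hx0, hx1, ?_, ?_⟩
  · have h1 : |s * ((1 - |z|) * d)| = (1 - |z|) * d := by
      have : 0 ≤ (1 - |z|) * d := mul_nonneg (by linarith) hd
      rcases hs with rfl | rfl <;> simp [abs_of_nonneg this]
    have := abs_add_le z (s * ((1 - |z|) * d))
    rw [h1] at this
    nlinarith
  · have hpos : 0 < 1 - s * x := by linarith [le_abs_self (s * x)]
    rw [hfac, one_div, one_div, Real.log_inv, Real.log_inv, Real.log_mul hz1.ne' hpos.ne']
    have h := zw_log (s * x) hsx
    have h2 : (s * x) ^ 2 ≤ e ^ 2 := by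
      rw [← sq_abs, habs]; exact pow_le_pow_left₀ hx0 hx1 2
    linarith

lemma zw_xi {Ω : Type*} [mΩ : MeasurableSpace Ω] (μ : Measure Ω) [IsProbabilityMeasure μ]
    (xi : Ω → ℝ) (hm : Measurable xi) (h1 : μ {ω | xi ω = 1} = 1 / 2)
    (h2 : μ {ω | xi ω = -1} = 1 / 2) : ∀ᵐ ω ∂μ, xi ω = 1 ∨ xi ω = -1 := by
  have m1 : MeasurableSet {ω | xi ω = 1} := hm (measurableSet_singleton 1)
  have m2 : MeasurableSet {ω | xi ω = -1} := hm (measurableSet_singleton (-1))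
  have hu : μ ({ω | xi ω = 1} ∪ {ω | xi ω = -1}) = 1 := by
    rw [measure_union _ m2, h1, h2, ENNReal.add_halves]
    rw [Set.disjoint_left]
    intro ω (h : xi ω = 1) (h' : xi ω = -1)
    linarith
  have := (prob_compl_eq_zero_iff (m1.union m2)).2 hu
  exact this

lemma zw_abs {Ω : Type*} [mΩ : MeasurableSpace Ω] (μ : Measure Ω) [IsProbabilityMeasure μ]
    (del : ℝ) (hdel : del ≤ 1 / 2) (W : ZenoWalk μ 0 1 del) (i : ℕ) :
    ∀ᵐ ω ∂μ, |W.Z i ω| < 1 := by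
  induction i with
  | zero =>
    filter_upwards [W.Z_zero] with ω h
    simp [h]
  | succ i ih =>
    filter_upwards [ih, W.d_mem i, W.step i, zw_xi μ (W.xi i)
      ((W.meas_xi i).mono (W.F.le _) le_rfl) (W.xi_plus i) (W.xi_minus i)] with ω h hd hs hx
    rw [hs]
    simp only [sub_zero]
    exact (zw_step _ _ _ _ h hd.1 hd.2 hdel rfl _ hx).2.2.1

lemma zw_mgf {Ω : Type*} [mΩ : MeasurableSpace Ω] (μ : Measure Ω) [IsProbabilityMeasure μ]
    (del : ℝ) (hdel : del ≤ 1 / 2) (W : ZenoWalk μ 0 1 del) (t : ℝ) (ht : 0 ≤ t) (i : ℕ) :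
    ∫⁻ ω, ENNReal.ofReal (Real.exp (t * Real.log (1 / (1 - W.Z i ω)))) ∂μ ≤
      ENNReal.ofReal (Real.exp (i * (t ^ 2 * del ^ 2 / 2 + 2 * t * del ^ 2))) := by
  induction i with
  | zero =>
    have : ∫⁻ ω, ENNReal.ofReal (Real.exp (t * Real.log (1 / (1 - W.Z 0 ω)))) ∂μ =
        ∫⁻ ω, 1 ∂μ := by
      apply lintegral_congr_ae
      filter_upwards [W.Z_zero] with ω h
      simp [h]
    rw [this]; simp
  | succ i ih =>
    have hxm : Measurable (W.xi i) := (W.meas_xi i).mono (W.F.le _) le_rfl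
    set x : Ω → ℝ := fun ω => (1 - |W.Z i ω|) / (1 - W.Z i ω) * W.d i ω with hxdef
    set g : ℝ → Ω → ENNReal := fun s ω => ENNReal.ofReal
      (Real.exp (t * (Real.log (1 / (1 - W.Z i ω)) + s * x ω + 2 * del ^ 2))) with hg
    have gm : ∀ s, Measurable[W.F i] (g s) := by
      intro s
      have hZ := W.meas_Z i
      have hd := W.meas_d i
      simp only [hg, hxdef]
      refine ENNReal.measurable_ofReal.comp (Real.measurable_exp.comp ?_)
      refine Measurable.const_mul (Measurable.add_const (Measurable.add ?_ ?_) _) _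
      · exact Real.measurable_log.comp ((measurable_const.sub hZ).const_div 1)
      · refine Measurable.const_mul (Measurable.mul (Measurable.div ?_ ?_) hd) _
        · exact measurable_const.sub (measurable_norm.comp hZ)
        · exact measurable_const.sub hZ
    set I : ℝ → Ω → ENNReal := fun s => ({ω | W.xi i ω = s}).indicator 1 with hI
    have hms : ∀ s, MeasurableSet[MeasurableSpace.comap (W.xi i) inferInstance]
        {ω | W.xi i ω = s} := fun s => ⟨{s}, measurableSet_singleton s, rfl⟩
    have Im : ∀ s, Measurable[MeasurableSpace.comap (W.xi i) inferInstance] (I s) :=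
      fun s => Measurable.indicator measurable_const (hms s)
    have key : ∀ s, ∫⁻ ω, I s ω * g s ω ∂μ = μ {ω | W.xi i ω = s} * ∫⁻ ω, g s ω ∂μ := by
      intro s
      rw [lintegral_mul_eq_lintegral_mul_lintegral_of_independent_measurableSpace
        hxm.comap_le (W.F.le i) (W.xi_indep i) (Im s) (gm s)]
      have hone : ∫⁻ ω, I s ω ∂μ = μ {ω | W.xi i ω = s} :=
        lintegral_indicator_one (hxm (measurableSet_singleton s))
      rw [hone]
    have gm' : ∀ s, Measurable (g s) := fun s => (gm s).mono (W.F.le i) le_rfl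
    have Im' : ∀ s, Measurable (I s) := fun s => (Im s).mono hxm.comap_le le_rfl
    calc _ ≤ ∫⁻ ω, (I 1 ω * g 1 ω + I (-1) ω * g (-1) ω) ∂μ := by
          apply lintegral_mono_ae
          filter_upwards [zw_abs μ del hdel W i, W.d_mem i, W.step i,
            zw_xi μ (W.xi i) hxm (W.xi_plus i) (W.xi_minus i)] with ω h hd hs hx
          have h4 := (zw_step _ _ _ _ h hd.1 hd.2 hdel rfl _ hx).2.2.2
          rw [hs]
          simp only [sub_zero]
          have h5 : ENNReal.ofReal (Real.exp (t * Real.log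
              (1 / (1 - (W.Z i ω + W.xi i ω * ((1 - |W.Z i ω|) * W.d i ω)))))) ≤
              g (W.xi i ω) ω :=
            ENNReal.ofReal_le_ofReal (Real.exp_le_exp.2 (mul_le_mul_of_nonneg_left h4 ht))
          refine h5.trans ?_
          rcases hx with hx | hx
          · rw [hx]
            have : I 1 ω = 1 := by simp [hI, hx]
            rw [this, one_mul]; exact le_self_add
          · rw [hx]
            have : I (-1) ω = 1 := by simp [hI, hx]
            rw [this, one_mul]; exact le_add_self
      _ = ∫⁻ ω, (1 / 2) * (g 1 ω + g (-1) ω) ∂μ := by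
          have hmul : Measurable (fun ω => I 1 ω * g 1 ω) := (Im' 1).mul (gm' 1)
          have hadd : Measurable (fun ω => g 1 ω + g (-1) ω) := (gm' 1).add (gm' (-1))
          rw [lintegral_add_left hmul, key, key, W.xi_plus, W.xi_minus,
            lintegral_const_mul _ hadd, lintegral_add_left (gm' 1), mul_add]
      _ ≤ ∫⁻ ω, ENNReal.ofReal (Real.exp (t ^ 2 * del ^ 2 / 2 + 2 * t * del ^ 2)) *
            ENNReal.ofReal (Real.exp (t * Real.log (1 / (1 - W.Z i ω)))) ∂μ := by
          apply lintegral_mono_ae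
          filter_upwards [zw_abs μ del hdel W i, W.d_mem i] with ω h hd
          obtain ⟨h0, h1, -, -⟩ := zw_step _ _ _ _ h hd.1 hd.2 hdel rfl 1 (Or.inl rfl)
          change 0 ≤ x ω at h0
          change x ω ≤ del at h1
          have e2 : (1 / 2 : ENNReal) = ENNReal.ofReal (1 / 2) := by
            rw [ENNReal.ofReal_div_of_pos (by norm_num)]; simp
          rw [e2]
          simp only [hg]
          rw [← ENNReal.ofReal_add (Real.exp_pos _).le (Real.exp_pos _).le,
            ← ENNReal.ofReal_mul (by norm_num), ← ENNReal.ofReal_mul (Real.exp_pos _).le]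
          apply ENNReal.ofReal_le_ofReal
          generalize Real.log (1 / (1 - W.Z i ω)) = L
          have hc := Real.cosh_le_exp_half_sq (t * x ω)
          have hle : Real.exp ((t * x ω) ^ 2 / 2) ≤ Real.exp (t ^ 2 * del ^ 2 / 2) := by
            apply Real.exp_le_exp.2
            rw [mul_pow]
            have := pow_le_pow_left₀ h0 h1 2
            have := mul_le_mul_of_nonneg_left this (sq_nonneg t)
            linarith
          have E : 1 / 2 * (Real.exp (t * (L + 1 * x ω + 2 * del ^ 2)) +
              Real.exp (t * (L + -1 * x ω + 2 * del ^ 2))) =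
              Real.cosh (t * x ω) * Real.exp (2 * t * del ^ 2 + t * L) := by
            have e1 : t * (L + 1 * x ω + 2 * del ^ 2) =
                t * x ω + (2 * t * del ^ 2 + t * L) := by ring
            have e3 : t * (L + -1 * x ω + 2 * del ^ 2) =
                -(t * x ω) + (2 * t * del ^ 2 + t * L) := by ring
            rw [Real.cosh_eq, e1, e3, Real.exp_add (t * x ω), Real.exp_add (-(t * x ω))]
            ring
          rw [E, ← Real.exp_add]
          calc _ ≤ Real.exp (t ^ 2 * del ^ 2 / 2) * Real.exp (2 * t * del ^ 2 + t * L) :=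
                mul_le_mul_of_nonneg_right (hc.trans hle) (Real.exp_pos _).le
            _ = _ := by rw [← Real.exp_add]; ring_nf
            _ ≤ _ := le_rfl
      _ = ENNReal.ofReal (Real.exp (t ^ 2 * del ^ 2 / 2 + 2 * t * del ^ 2)) *
            ∫⁻ ω, ENNReal.ofReal (Real.exp (t * Real.log (1 / (1 - W.Z i ω)))) ∂μ := by
          rw [lintegral_const_mul' _ _ ENNReal.ofReal_ne_top]
      _ ≤ _ := by
          refine (mul_le_mul_right ih _).trans ?_
          rw [← ENNReal.ofReal_mul (Real.exp_pos _).le, ← Real.exp_add]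
          apply le_of_eq
          congr 2
          push_cast; ring

theorem statement2 :
    ∃ C : ℝ, 0 < C ∧ ∃ c : ℝ, 0 < c ∧
      ∀ {Ω : Type} [mΩ : MeasurableSpace Ω] (μ : Measure Ω),
        IsProbabilityMeasure μ →
        ∀ del : ℝ, del ∈ Set.Ioc (0 : ℝ) (1 / 2) →
        ∀ W : ZenoWalk μ 0 1 del, ∀ i : ℕ, 1 ≤ i → ∀ k : ℝ, 1 ≤ k →
        μ {ω | del * k * Real.sqrt i + C * i * del ^ 2
                ≤ Real.log (1 / (1 - W.Z i ω))}
          ≤ ENNReal.ofReal (Real.exp (-c * k ^ 2)) := by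
  refine ⟨2, by norm_num, 1 / 2, by norm_num, ?_⟩
  intro Ω mΩ μ hμ del hdel W i hi k hk
  have hi0 : (0 : ℝ) < i := by exact_mod_cast hi
  have hs : 0 < Real.sqrt i := Real.sqrt_pos.2 hi0
  have hss : Real.sqrt i ^ 2 = i := Real.sq_sqrt hi0.le
  have hd0 : 0 < del := hdel.1
  set t : ℝ := k / (del * Real.sqrt i) with ht
  have htp : 0 < t := by positivity
  have htd : t * del * Real.sqrt i = k := by rw [ht]; field_simp
  set a : ℝ := del * k * Real.sqrt i + 2 * i * del ^ 2 with ha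
  have hm := zw_mgf μ del hdel.2 W t htp.le i
  have hZ : Measurable (W.Z i) := (W.meas_Z i).mono (W.F.le i) le_rfl
  have hmeas : Measurable
      (fun ω => ENNReal.ofReal (Real.exp (t * Real.log (1 / (1 - W.Z i ω))))) :=
    ENNReal.measurable_ofReal.comp (Real.measurable_exp.comp
      ((Real.measurable_log.comp ((measurable_const.sub hZ).const_div 1)).const_mul t))
  have hmk := mul_meas_ge_le_lintegral (μ := μ) hmeas (ENNReal.ofReal (Real.exp (t * a)))
  have hsub : μ {ω | a ≤ Real.log (1 / (1 - W.Z i ω))} ≤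
      μ {ω | ENNReal.ofReal (Real.exp (t * a)) ≤
        ENNReal.ofReal (Real.exp (t * Real.log (1 / (1 - W.Z i ω))))} := by
    apply measure_mono
    intro ω (hω : a ≤ _)
    exact ENNReal.ofReal_le_ofReal (Real.exp_le_exp.2 (mul_le_mul_of_nonneg_left hω htp.le))
  have hfin := (mul_le_mul_right hsub (ENNReal.ofReal (Real.exp (t * a)))).trans (hmk.trans hm)
  have hpos : ENNReal.ofReal (Real.exp (t * a)) ≠ 0 := by
    simpa using Real.exp_pos (t * a)
  rw [← ENNReal.mul_le_mul_iff_right hpos ENNReal.ofReal_ne_top]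
  refine hfin.trans (le_of_eq ?_)
  rw [← ENNReal.ofReal_mul (Real.exp_pos _).le, ← Real.exp_add]
  congr 2
  have h1 : t * (del * k * Real.sqrt i) = k ^ 2 := by
    calc _ = (t * del * Real.sqrt i) * k := by ring
      _ = _ := by rw [htd]; ring
  have h2 : t ^ 2 * del ^ 2 * i = k ^ 2 := by
    rw [← htd, ← hss]; simp only [hss]; ring_nf; rw [hss]
  rw [ha]
  linear_combination (1 / 2) * h2 - h1
end

section
/- For every a > 0 there is a constant C = C(a) > 0 such that for every δ ∈ (0, 1/2], every standard Zeno walk (Z_i) with parameter δ, and every index ℓ ≥ 0 with ℓ ≤ a/δ²: E[1/(1 − Z_ℓ)] ≤ C. -/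
open MeasureTheory ProbabilityTheory

theorem zeno_xi {Ω : Type} [mΩ : MeasurableSpace Ω] (μ : Measure Ω) [IsProbabilityMeasure μ]
    {del : ℝ} (W : ZenoWalk μ 0 1 del) (i : ℕ) : ∀ᵐ ω ∂μ, W.xi i ω = 1 ∨ W.xi i ω = -1 := by
  have hm : Measurable (W.xi i) := (W.meas_xi i).mono (W.F.le _) le_rfl
  have h1 : MeasurableSet {ω | W.xi i ω = 1} := hm (measurableSet_singleton 1)
  have h2 : MeasurableSet {ω | W.xi i ω = -1} := hm (measurableSet_singleton (-1))
  have hd : Disjoint {ω | W.xi i ω = 1} {ω | W.xi i ω = -1} := by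
    rw [Set.disjoint_left]
    intro ω h h'
    simp only [Set.mem_ofPred_eq] at h h'
    linarith
  have hu : μ ({ω | W.xi i ω = 1} ∪ {ω | W.xi i ω = -1}) = 1 := by
    rw [measure_union hd h2, W.xi_plus, W.xi_minus, ENNReal.add_halves]
  have := (prob_compl_eq_zero_iff (h1.union h2)).2 hu
  filter_upwards [compl_mem_ae_iff.2 this] with ω hω
  simp at hω
  tauto

theorem zeno_abs {Ω : Type} [mΩ : MeasurableSpace Ω] (μ : Measure Ω) [IsProbabilityMeasure μ]
    {del : ℝ} (hdel : del ≤ 1 / 2) (W : ZenoWalk μ 0 1 del) (i : ℕ) :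
    ∀ᵐ ω ∂μ, |W.Z i ω| < 1 := by
  induction i with
  | zero => filter_upwards [W.Z_zero] with ω h; simp [h]
  | succ i ih =>
    filter_upwards [ih, W.step i, W.d_mem i, zeno_xi μ W i] with ω h1 h2 h3 h4
    obtain ⟨h3a, h3b⟩ := h3
    rw [h2, sub_zero]
    have h5 : 0 ≤ (1 - |W.Z i ω|) * W.d i ω := mul_nonneg (by linarith) h3a
    have h6 : (1 - |W.Z i ω|) * W.d i ω ≤ (1 - |W.Z i ω|) * (1 / 2) :=
      mul_le_mul_of_nonneg_left (by linarith) (by linarith)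
    have h7 := le_abs_self (W.Z i ω)
    have h8 := neg_abs_le (W.Z i ω)
    rw [abs_lt]
    rcases h4 with h | h <;> rw [h] <;> constructor <;> linarith

theorem zeno_real (w s del : ℝ) (hw : 0 < w) (hs : 0 ≤ s) (hd0 : 0 < del) (hd : del ≤ 1 / 2)
    (h : s ≤ w * del) :
    1 / (w - s) + 1 / (w + s) ≤ 2 * ((1 + 2 * del ^ 2) * (1 / w)) := by
  have h1 : s < w := by nlinarith
  have h2 : s ^ 2 ≤ (w * del) ^ 2 := by gcongr
  have h4 : del ^ 2 ≤ 1 / 4 := by nlinarith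
  have e1 : 1 / (w - s) + 1 / (w + s) = 2 * w / (w ^ 2 - s ^ 2) := by
    have : w - s ≠ 0 := by linarith
    have : w + s ≠ 0 := by linarith
    have : w ^ 2 - s ^ 2 ≠ 0 := by
      have : 0 < (w - s) * (w + s) := mul_pos (by linarith) (by linarith)
      nlinarith
    field_simp
    ring
  have e2 : 2 * ((1 + 2 * del ^ 2) * (1 / w)) = 2 * (1 + 2 * del ^ 2) / w := by ring
  have h5 : 0 < w ^ 2 - s ^ 2 := by nlinarith
  rw [e1, e2, div_le_div_iff₀ h5 hw]
  have h6 : w ^ 2 * (1 - del ^ 2) ≤ w ^ 2 - s ^ 2 := by nlinarith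
  have h7 : 1 ≤ (1 + 2 * del ^ 2) * (1 - del ^ 2) := by nlinarith [sq_nonneg del]
  have h8 : w ^ 2 * 1 ≤ w ^ 2 * ((1 + 2 * del ^ 2) * (1 - del ^ 2)) := by gcongr
  have h9 : (1 + 2 * del ^ 2) * (w ^ 2 * (1 - del ^ 2)) ≤ (1 + 2 * del ^ 2) * (w ^ 2 - s ^ 2) := by
    gcongr
  nlinarith

theorem zeno_fac {Ω : Type} [mΩ : MeasurableSpace Ω] (μ : Measure Ω) [IsProbabilityMeasure μ]
    {del : ℝ} (W : ZenoWalk μ 0 1 del) (i : ℕ) (c : ℝ) (hc : μ {ω | W.xi i ω = c} = 1 / 2)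
    (g : Ω → ENNReal) (hg : Measurable[W.F i] g) :
    ∫⁻ ω, ({ω | W.xi i ω = c}.indicator (fun _ => 1) ω) * g ω ∂μ = 1 / 2 * ∫⁻ ω, g ω ∂μ := by
  have hm : Measurable (W.xi i) := (W.meas_xi i).mono (W.F.le _) le_rfl
  have h1 : MeasurableSet {ω | W.xi i ω = c} := hm (measurableSet_singleton c)
  have h1' : MeasurableSet[MeasurableSpace.comap (W.xi i) inferInstance] {ω | W.xi i ω = c} :=
    ⟨{c}, measurableSet_singleton c, rfl⟩
  have := lintegral_mul_eq_lintegral_mul_lintegral_of_independent_measurableSpace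
    (μ := μ) hm.comap_le (W.F.le i) (W.xi_indep i)
    (f := {ω | W.xi i ω = c}.indicator (fun _ => (1 : ENNReal))) (g := g)
    (Measurable.indicator measurable_const h1') hg
  rw [this, lintegral_indicator_const h1, hc, one_mul]

theorem zeno_step {Ω : Type} [mΩ : MeasurableSpace Ω] (μ : Measure Ω) [IsProbabilityMeasure μ]
    {del : ℝ} (hd0 : 0 < del) (hdel : del ≤ 1 / 2) (W : ZenoWalk μ 0 1 del) (i : ℕ) :
    ∫⁻ ω, ENNReal.ofReal (1 / (1 - W.Z (i + 1) ω)) ∂μ ≤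
      ENNReal.ofReal (1 + 2 * del ^ 2) * ∫⁻ ω, ENNReal.ofReal (1 / (1 - W.Z i ω)) ∂μ := by
  let s : Ω → ℝ := fun ω => (1 - |W.Z i ω|) * W.d i ω
  let gp : Ω → ENNReal := fun ω => ENNReal.ofReal (1 / (1 - W.Z i ω - s ω))
  let gm : Ω → ENNReal := fun ω => ENNReal.ofReal (1 / (1 - W.Z i ω + s ω))
  have hZ := W.meas_Z i
  have hD := W.meas_d i
  have hs : Measurable[W.F i] s := (measurable_const.sub (continuous_abs.measurable.comp hZ)).mul hD
  have hgp : Measurable[W.F i] gp :=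
    (measurable_const.div ((measurable_const.sub hZ).sub hs)).ennreal_ofReal
  have hgm : Measurable[W.F i] gm :=
    (measurable_const.div ((measurable_const.sub hZ).add hs)).ennreal_ofReal
  have hm : Measurable (W.xi i) := (W.meas_xi i).mono (W.F.le _) le_rfl
  have h1 : MeasurableSet {ω | W.xi i ω = 1} := hm (measurableSet_singleton 1)
  have hI : Measurable fun ω => ({ω | W.xi i ω = 1}.indicator (fun _ => (1 : ENNReal)) ω) * gp ω :=
    (measurable_const.indicator h1).mul (hgp.mono (W.F.le i) le_rfl)
  have hgp' : Measurable gp := hgp.mono (W.F.le i) le_rfl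
  have hZ' : Measurable (W.Z i) := hZ.mono (W.F.le i) le_rfl
  calc ∫⁻ ω, ENNReal.ofReal (1 / (1 - W.Z (i + 1) ω)) ∂μ
      = ∫⁻ ω, (({ω | W.xi i ω = 1}.indicator (fun _ => 1) ω) * gp ω +
          ({ω | W.xi i ω = -1}.indicator (fun _ => 1) ω) * gm ω) ∂μ := by
        apply lintegral_congr_ae
        filter_upwards [W.step i, zeno_xi μ W i] with ω h2 h4
        rw [h2, sub_zero]
        rcases h4 with h | h
        · have hn : ¬ ((1 : ℝ) = -1) := by norm_num
          simp only [Set.indicator, Set.mem_ofPred_eq, h, hn, if_true, if_false, one_mul, zero_mul,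
            add_zero, gp, s]
          congr 2; ring
        · have hn : ¬ ((-1 : ℝ) = 1) := by norm_num
          simp only [Set.indicator, Set.mem_ofPred_eq, h, hn, if_true, if_false, one_mul, zero_mul,
            zero_add, gm, s]
          congr 2; ring
    _ = 1 / 2 * ∫⁻ ω, (gp ω + gm ω) ∂μ := by
        rw [lintegral_add_left hI,
          zeno_fac μ W i 1 (W.xi_plus i) gp hgp, zeno_fac μ W i (-1) (W.xi_minus i) gm hgm,
          lintegral_add_left hgp', mul_add]
    _ ≤ 1 / 2 * ∫⁻ ω, 2 * (ENNReal.ofReal (1 + 2 * del ^ 2) *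
          ENNReal.ofReal (1 / (1 - W.Z i ω))) ∂μ := by
        gcongr 1 / 2 * ?_
        apply lintegral_mono_ae
        filter_upwards [zeno_abs μ hdel W i, W.d_mem i] with ω ha hd
        obtain ⟨hda, hdb⟩ := hd
        have h7 := le_abs_self (W.Z i ω)
        have hw : 0 < 1 - W.Z i ω := by linarith
        have hs0 : 0 ≤ s ω := mul_nonneg (by linarith) hda
        have hsle : s ω ≤ (1 - W.Z i ω) * del :=
          mul_le_mul (by linarith) hdb hda hw.le
        have hlt : s ω < 1 - W.Z i ω := by nlinarith
        have key := zeno_real (1 - W.Z i ω) (s ω) del hw hs0 hd0 hdel hsle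
        have e2 : (2 : ENNReal) = ENNReal.ofReal 2 := by simp
        rw [e2, ← ENNReal.ofReal_mul (by positivity), ← ENNReal.ofReal_mul (by positivity)]
        simp only [gp, gm]
        rw [← ENNReal.ofReal_add (one_div_nonneg.2 (by linarith))
          (one_div_nonneg.2 (by linarith))]
        exact ENNReal.ofReal_le_ofReal key
    _ = _ := by
        have hq : Measurable fun ω => ENNReal.ofReal (1 / (1 - W.Z i ω)) :=
          (measurable_const.div (measurable_const.sub hZ')).ennreal_ofReal
        rw [lintegral_const_mul _ (hq.const_mul _), lintegral_const_mul _ hq, ← mul_assoc,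
          one_div, ENNReal.inv_mul_cancel (by simp) (by simp), one_mul]

theorem statement3 (a : ℝ) (ha : 0 < a) :
    ∃ C : ℝ, 0 < C ∧
      ∀ {Ω : Type} [mΩ : MeasurableSpace Ω] (μ : Measure Ω),
        IsProbabilityMeasure μ →
        ∀ del : ℝ, del ∈ Set.Ioc (0 : ℝ) (1 / 2) →
        ∀ W : ZenoWalk μ 0 1 del, ∀ l : ℕ, (l : ℝ) ≤ a / del ^ 2 →
        ∫⁻ ω, ENNReal.ofReal (1 / (1 - W.Z l ω)) ∂μ ≤ ENNReal.ofReal C := by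
  refine ⟨Real.exp (2 * a), Real.exp_pos _, ?_⟩
  intro Ω mΩ μ hμ del hdel W l hl
  obtain ⟨hd0, hd⟩ := hdel
  have main : ∀ n : ℕ, ∫⁻ ω, ENNReal.ofReal (1 / (1 - W.Z n ω)) ∂μ ≤
      ENNReal.ofReal ((1 + 2 * del ^ 2) ^ n) := by
    intro n
    induction n with
    | zero =>
      have : ∫⁻ ω, ENNReal.ofReal (1 / (1 - W.Z 0 ω)) ∂μ = ∫⁻ _, 1 ∂μ := by
        apply lintegral_congr_ae
        filter_upwards [W.Z_zero] with ω h
        simp [h]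
      rw [this]
      simp
    | succ n ih =>
      refine (zeno_step μ hd0 hd W n).trans ?_
      rw [pow_succ' _ n, ENNReal.ofReal_mul (by positivity)]
      gcongr
  refine (main l).trans (ENNReal.ofReal_le_ofReal ?_)
  have h1 : 1 + 2 * del ^ 2 ≤ Real.exp (2 * del ^ 2) := by
    linarith [Real.add_one_le_exp (2 * del ^ 2)]
  calc (1 + 2 * del ^ 2) ^ l ≤ Real.exp (2 * del ^ 2) ^ l := by gcongr
    _ = Real.exp (l * (2 * del ^ 2)) := by rw [← Real.exp_nat_mul]
    _ ≤ Real.exp (2 * a) := by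
      apply Real.exp_le_exp.2
      rw [le_div_iff₀ (by positivity)] at hl
      linarith
end

section
/- For every a > 0 there is a constant C = C(a) > 0 such that for every δ ∈ (0, 1/2], every standard Zeno walk (Z_i) with parameter δ, and every index ℓ ≥ 0 with ℓ ≤ a/δ²: E[1/α_ℓ] ≤ C, where α_ℓ := 1 − |Z_ℓ|. -/
open MeasureTheory ProbabilityTheory

noncomputable def zphi (z : ℝ) : ℝ := 1 / (1 - z) + 1 / (1 + z)

lemma zphi_meas : Measurable zphi := by unfold zphi; fun_prop

lemma z_aux (u s D : ℝ) (hu : 0 < u) (hs : 0 ≤ s) (hD : 0 ≤ D) (hD2 : D ≤ 1 / 2)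
    (h : s ≤ u * D) : 1 / (u - s) + 1 / (u + s) ≤ 2 * Real.exp (2 * D ^ 2) * (1 / u) := by
  have hsu : s < u := by nlinarith
  have h1 : 0 < u - s := by linarith
  have h2 : 0 < u + s := by linarith
  have he : 1 + 2 * D ^ 2 ≤ Real.exp (2 * D ^ 2) := by
    linarith [Real.add_one_le_exp (2 * D ^ 2)]
  have hss : s ^ 2 ≤ u ^ 2 * D ^ 2 := by
    rw [← mul_pow]; exact pow_le_pow_left₀ hs h 2
  have hDD : D ^ 2 ≤ 1 / 4 := by nlinarith
  have key : 1 / (u - s) + 1 / (u + s) ≤ 2 * (1 + 2 * D ^ 2) * (1 / u) := by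
    rw [div_add_div _ _ h1.ne' h2.ne', mul_one_div, div_le_div_iff₀ (by positivity) hu]
    have h3 : (1 + 2 * D ^ 2) * s ^ 2 ≤ (1 + 2 * D ^ 2) * (u ^ 2 * D ^ 2) :=
      mul_le_mul_of_nonneg_left hss (by positivity)
    have h4 : 0 ≤ u ^ 2 * (D ^ 2 * (1 - 2 * D ^ 2)) := by
      apply mul_nonneg (by positivity) (mul_nonneg (by positivity) (by linarith))
    nlinarith
  refine key.trans ?_
  have : 0 ≤ 1 / u := by positivity
  gcongr

lemma zphi_step (z d D : ℝ) (hz : |z| < 1) (hd : d ∈ Set.Icc 0 D) (hD2 : D ≤ 1 / 2) :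
    zphi (z + (1 - |z|) * d) + zphi (z - (1 - |z|) * d)
      ≤ 2 * Real.exp (2 * D ^ 2) * zphi z := by
  obtain ⟨h0, h1⟩ := hd
  obtain ⟨hz1, hz2⟩ := abs_lt.mp hz
  have hs : 0 ≤ (1 - |z|) * d := mul_nonneg (by linarith) h0
  have a1 := z_aux (1 - z) ((1 - |z|) * d) D (by linarith) hs (by linarith) hD2
    (mul_le_mul (by linarith [le_abs_self z]) h1 h0 (by linarith))
  have a2 := z_aux (1 + z) ((1 - |z|) * d) D (by linarith) hs (by linarith) hD2
    (mul_le_mul (by linarith [neg_abs_le z]) h1 h0 (by linarith))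
  unfold zphi
  rw [show 1 - (z + (1 - |z|) * d) = 1 - z - (1 - |z|) * d by ring,
    show 1 + (z + (1 - |z|) * d) = 1 + z + (1 - |z|) * d by ring,
    show 1 - (z - (1 - |z|) * d) = 1 - z + (1 - |z|) * d by ring,
    show 1 + (z - (1 - |z|) * d) = 1 + z - (1 - |z|) * d by ring, mul_add]
  linarith

lemma zphi_nonneg (z : ℝ) (hz : |z| < 1) : 0 ≤ zphi z := by
  obtain ⟨hz1, hz2⟩ := abs_lt.mp hz
  unfold zphi
  have : 0 < 1 - z := by linarith
  have : 0 < 1 + z := by linarith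
  positivity

lemma z_abs_step (z d D x : ℝ) (hz : |z| < 1) (hd : d ∈ Set.Icc 0 D) (hD2 : D ≤ 1 / 2)
    (hx : x = 1 ∨ x = -1) : |z + x * ((1 - |z|) * d)| < 1 := by
  obtain ⟨h0, h1⟩ := hd
  have h2 : |x| = 1 := by rcases hx with rfl | rfl <;> simp
  have h3 := abs_add_le z (x * ((1 - |z|) * d))
  rw [abs_mul x, h2, one_mul, abs_of_nonneg (mul_nonneg (by linarith) h0)] at h3
  nlinarith

section
variable {Ω : Type} [mΩ : MeasurableSpace Ω] {μ : Measure Ω} [IsProbabilityMeasure μ]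
  {D : ℝ} (W : ZenoWalk μ 0 1 D)

lemma z_xi_ae (i : ℕ) : ∀ᵐ ω ∂μ, W.xi i ω = 1 ∨ W.xi i ω = -1 := by
  have hm : Measurable (W.xi i) := (W.meas_xi i).mono (W.F.le _) le_rfl
  have m1 : MeasurableSet {ω | W.xi i ω = 1} := hm (measurableSet_singleton 1)
  have m2 : MeasurableSet {ω | W.xi i ω = -1} := hm (measurableSet_singleton (-1))
  have hd : Disjoint {ω | W.xi i ω = 1} {ω | W.xi i ω = -1} := by
    rw [Set.disjoint_left]
    intro ω h1 h2
    simp only [Set.mem_ofPred_eq] at h1 h2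
    linarith
  have h := measure_union (μ := μ) hd m2
  rw [W.xi_plus, W.xi_minus, ENNReal.add_halves] at h
  exact (prob_compl_eq_zero_iff (m1.union m2)).mpr h

lemma z_abs_ae (hD2 : D ≤ 1 / 2) (i : ℕ) : ∀ᵐ ω ∂μ, |W.Z i ω| < 1 := by
  induction i with
  | zero =>
    filter_upwards [W.Z_zero] with ω h
    simp [h]
  | succ i ih =>
    filter_upwards [ih, W.step i, W.d_mem i, z_xi_ae W i] with ω h1 h2 h3 h4
    rw [h2, sub_zero]
    exact z_abs_step _ _ D _ h1 h3 hD2 h4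

lemma z_indep_int (i : ℕ) (c : ℝ) (hc : μ {ω | W.xi i ω = c} = 1 / 2) (f : Ω → ENNReal)
    (hf : Measurable[W.F i] f) :
    ∫⁻ ω, Set.indicator {ω | W.xi i ω = c} 1 ω * f ω ∂μ = 1 / 2 * ∫⁻ ω, f ω ∂μ := by
  have hm : Measurable (W.xi i) := (W.meas_xi i).mono (W.F.le _) le_rfl
  have m1 : MeasurableSet {ω | W.xi i ω = c} := hm (measurableSet_singleton c)
  have m2 : MeasurableSet[MeasurableSpace.comap (W.xi i) inferInstance] {ω | W.xi i ω = c} :=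
    ⟨{c}, measurableSet_singleton c, rfl⟩
  have m3 : Measurable[MeasurableSpace.comap (W.xi i) inferInstance]
      (Set.indicator {ω | W.xi i ω = c} (1 : Ω → ENNReal)) := by
    have h1 : Measurable (Set.indicator {c} (1 : ℝ → ENNReal)) :=
      measurable_one.indicator (measurableSet_singleton c)
    exact h1.comp (comap_measurable (W.xi i))
  rw [lintegral_mul_eq_lintegral_mul_lintegral_of_independent_measurableSpace hm.comap_le
    (W.F.le i) (W.xi_indep i) m3 hf, lintegral_indicator_one m1, hc]

lemma z_int_step (hD2 : D ≤ 1 / 2) (i : ℕ) :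
    ∫⁻ ω, ENNReal.ofReal (zphi (W.Z (i + 1) ω)) ∂μ
      ≤ ENNReal.ofReal (Real.exp (2 * D ^ 2)) * ∫⁻ ω, ENNReal.ofReal (zphi (W.Z i ω)) ∂μ := by
  set fp : Ω → ENNReal := fun ω => ENNReal.ofReal (zphi (W.Z i ω + (1 - |W.Z i ω|) * W.d i ω))
    with hfp
  set fm : Ω → ENNReal := fun ω => ENNReal.ofReal (zphi (W.Z i ω - (1 - |W.Z i ω|) * W.d i ω))
    with hfm
  have hZ := W.meas_Z i
  have hd := W.meas_d i
  have hα : Measurable[W.F i] fun ω => (1 - |W.Z i ω|) * W.d i ω :=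
    (measurable_const.sub (measurable_abs.comp hZ)).mul hd
  have mp : Measurable[W.F i] fp :=
    ENNReal.measurable_ofReal.comp (zphi_meas.comp (hZ.add hα))
  have mm : Measurable[W.F i] fm :=
    ENNReal.measurable_ofReal.comp (zphi_meas.comp (hZ.sub hα))
  have mp' : Measurable fp := mp.mono (W.F.le i) le_rfl
  have hm : Measurable (W.xi i) := (W.meas_xi i).mono (W.F.le _) le_rfl
  have m1 : MeasurableSet {ω | W.xi i ω = 1} := hm (measurableSet_singleton 1)
  have e1 : ∫⁻ ω, ENNReal.ofReal (zphi (W.Z (i + 1) ω)) ∂μ =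
      ∫⁻ ω, (Set.indicator {ω | W.xi i ω = 1} 1 ω * fp ω
        + Set.indicator {ω | W.xi i ω = -1} 1 ω * fm ω) ∂μ := by
    apply lintegral_congr_ae
    filter_upwards [W.step i, z_xi_ae W i] with ω h2 h4
    rw [h2, sub_zero]
    rcases h4 with h | h
    · simp [Set.indicator, h, hfp, show ¬ (1 : ℝ) = -1 by norm_num]
    · simp [Set.indicator, h, hfm, show ¬ (-1 : ℝ) = 1 by norm_num, sub_eq_add_neg]
  have m4 : Measurable fun ω => Set.indicator {ω | W.xi i ω = 1} (1 : Ω → ENNReal) ω * fp ω :=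
    (measurable_one.indicator m1).mul mp'
  rw [e1, lintegral_add_left m4,
    z_indep_int W i 1 (W.xi_plus i) fp mp, z_indep_int W i (-1) (W.xi_minus i) fm mm,
    ← mul_add, ← lintegral_add_left mp', ← lintegral_const_mul' _ _ (by simp),
    ← lintegral_const_mul' _ _ (by simp)]
  apply lintegral_mono_ae
  filter_upwards [z_abs_ae W hD2 i, W.d_mem i] with ω h1 h3
  have hs := zphi_step _ _ D h1 h3 hD2
  have hx : (0:ℝ) ≤ (1 - |W.Z i ω|) * W.d i ω := mul_nonneg (by linarith) h3.1
  have n1 := zphi_nonneg _ (by simpa using z_abs_step _ _ D 1 h1 h3 hD2 (Or.inl rfl))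
  have n2 := zphi_nonneg _ (z_abs_step _ _ D (-1) h1 h3 hD2 (Or.inr rfl))
  rw [neg_one_mul, ← sub_eq_add_neg] at n2
  simp only [hfp, hfm]
  rw [← ENNReal.ofReal_add n1 n2, ← ENNReal.ofReal_mul (Real.exp_pos _).le,
    show (1 / 2 : ENNReal) = ENNReal.ofReal (1 / 2) by
      rw [ENNReal.ofReal_div_of_pos (by norm_num)]; simp,
    ← ENNReal.ofReal_mul (by norm_num)]
  apply ENNReal.ofReal_le_ofReal
  linarith

lemma z_int (hD2 : D ≤ 1 / 2) (i : ℕ) :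
    ∫⁻ ω, ENNReal.ofReal (zphi (W.Z i ω)) ∂μ
      ≤ ENNReal.ofReal (2 * Real.exp (2 * D ^ 2 * i)) := by
  induction i with
  | zero =>
    have : ∫⁻ ω, ENNReal.ofReal (zphi (W.Z 0 ω)) ∂μ = ∫⁻ ω, ENNReal.ofReal 2 ∂μ := by
      apply lintegral_congr_ae
      filter_upwards [W.Z_zero] with ω h
      rw [h]; norm_num [zphi]
    rw [this]; simp
  | succ i ih =>
    refine (z_int_step W hD2 i).trans ((mul_le_mul_right ih _).trans ?_)
    rw [← ENNReal.ofReal_mul (Real.exp_pos _).le]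
    apply ENNReal.ofReal_le_ofReal
    rw [mul_left_comm, ← Real.exp_add]
    push_cast
    rw [show 2 * D ^ 2 + 2 * D ^ 2 * (i : ℝ) = 2 * D ^ 2 * (i + 1) by ring]

end

theorem statement4 (a : ℝ) (ha : 0 < a) :
    ∃ C : ℝ, 0 < C ∧
      ∀ {Ω : Type} [mΩ : MeasurableSpace Ω] (μ : Measure Ω),
        IsProbabilityMeasure μ →
        ∀ del : ℝ, del ∈ Set.Ioc (0 : ℝ) (1 / 2) →
        ∀ W : ZenoWalk μ 0 1 del, ∀ l : ℕ, (l : ℝ) ≤ a / del ^ 2 →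
        ∫⁻ ω, ENNReal.ofReal (1 / (1 - |W.Z l ω|)) ∂μ ≤ ENNReal.ofReal C := by
  refine ⟨2 * Real.exp (2 * a), by positivity, ?_⟩
  intro Ω mΩ μ hμ D hD W l hl
  have hl' : (l : ℝ) * D ^ 2 ≤ a := (le_div_iff₀ (pow_pos hD.1 2)).mp hl
  refine le_trans (lintegral_mono_ae ?_) ((z_int W hD.2 l).trans (ENNReal.ofReal_le_ofReal ?_))
  · filter_upwards [z_abs_ae W hD.2 l] with ω h
    apply ENNReal.ofReal_le_ofReal
    obtain ⟨hz1, hz2⟩ := abs_lt.mp h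
    have p1 : 0 < 1 / (1 - W.Z l ω) := by apply one_div_pos.mpr; linarith
    have p2 : 0 < 1 / (1 + W.Z l ω) := by apply one_div_pos.mpr; linarith
    unfold zphi
    rcases abs_choice (W.Z l ω) with h | h <;> rw [h]
    · linarith
    · rw [sub_neg_eq_add]; linarith
  · gcongr 2 * Real.exp ?_
    linarith
end

section
/- For every a > 0 there is a constant C = C(a) > 0 such that for every λ ∈ ℝ, every ε > 0, every δ ∈ (0, 1/2], every Zeno walk (Z_i) in (λ−ε, λ+ε) with parameter δ, and every index ℓ ≥ 0 with ℓ ≤ a/δ²: E[1/α_ℓ] ≤ C/ε, where α_ℓ := ε − |Z_ℓ − λ|. -/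
open MeasureTheory ProbabilityTheory

lemma zw_aux (u h δ : ℝ) (hu : 0 < u) (hδ0 : 0 < δ) (hδ : δ ≤ 1/2) (h0 : 0 ≤ h) (hh : h ≤ δ * u) :
    1 / (u - h) + 1 / (u + h) ≤ 2 * (1 + 2 * δ ^ 2) * (1 / u) := by
  have hlt : h < u := by nlinarith
  have h1 : 0 < u - h := by linarith
  have h2 : 0 < u + h := by linarith
  have hsq : h ^ 2 ≤ δ ^ 2 * u ^ 2 := by
    rw [← mul_pow]; exact pow_le_pow_left₀ h0 hh 2
  have hd2 : δ ^ 2 ≤ 1 / 4 := by nlinarith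
  have e1 : 1 / (u - h) + 1 / (u + h) = 2 * u / ((u - h) * (u + h)) := by
    field_simp; ring
  have e2 : 2 * (1 + 2 * δ ^ 2) * (1 / u) = 2 * (1 + 2 * δ ^ 2) / u := by ring
  rw [e1, e2, div_le_div_iff₀ (by positivity) hu]
  have h3 : (1 + 2 * δ ^ 2) * h ^ 2 ≤ (1 + 2 * δ ^ 2) * (δ ^ 2 * u ^ 2) := by gcongr
  have h4 : 0 ≤ u ^ 2 * (δ ^ 2 * (1 - 2 * δ ^ 2)) := by
    have : 0 ≤ 1 - 2 * δ ^ 2 := by linarith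
    positivity
  nlinarith

noncomputable def zwG (lam eps x : ℝ) : ℝ := 1 / (eps - (x - lam)) + 1 / (eps + (x - lam))

lemma zwG_meas (lam eps : ℝ) : Measurable (zwG lam eps) := by
  unfold zwG; fun_prop

lemma zwG_step (lam eps δ x h : ℝ) (hx : |x - lam| < eps) (hδ0 : 0 < δ) (hδ : δ ≤ 1/2)
    (h0 : 0 ≤ h) (hh : h ≤ δ * (eps - |x - lam|)) :
    zwG lam eps (x + h) + zwG lam eps (x - h) ≤ 2 * (1 + 2 * δ ^ 2) * zwG lam eps x := by
  have a1 := le_abs_self (x - lam)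
  have a2 := neg_abs_le (x - lam)
  have k1 := zw_aux (eps - (x - lam)) h δ (by linarith) hδ0 hδ h0 (by nlinarith)
  have k2 := zw_aux (eps + (x - lam)) h δ (by linarith) hδ0 hδ h0 (by nlinarith)
  unfold zwG
  have e1 : eps - (x + h - lam) = eps - (x - lam) - h := by ring
  have e2 : eps + (x + h - lam) = eps + (x - lam) + h := by ring
  have e3 : eps - (x - h - lam) = eps - (x - lam) + h := by ring
  have e4 : eps + (x - h - lam) = eps + (x - lam) - h := by ring
  rw [e1, e2, e3, e4]
  linarith

lemma zwG_nonneg (lam eps x : ℝ) (hx : |x - lam| < eps) : 0 ≤ zwG lam eps x := by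
  have := abs_lt.1 hx
  unfold zwG
  have : 0 < eps - (x - lam) := by linarith
  have : 0 < eps + (x - lam) := by linarith
  positivity

lemma zwG_ge (lam eps x : ℝ) (hx : |x - lam| < eps) :
    1 / (eps - |x - lam|) ≤ zwG lam eps x := by
  have := abs_lt.1 hx
  unfold zwG
  have h1 : 0 < 1 / (eps - (x - lam)) := one_div_pos.2 (by linarith)
  have h2 : 0 < 1 / (eps + (x - lam)) := one_div_pos.2 (by linarith)
  rcases abs_cases (x - lam) with ⟨h, _⟩ | ⟨h, _⟩
  · rw [h]; linarith
  · rw [h, sub_neg_eq_add]; linarith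

section
variable {Ω : Type} [mΩ : MeasurableSpace Ω] {μ : Measure Ω} [IsProbabilityMeasure μ]
  {lam eps del : ℝ}

lemma zw_xi_s5 (W : ZenoWalk μ lam eps del) (i : ℕ) : ∀ᵐ ω ∂μ, W.xi i ω = 1 ∨ W.xi i ω = -1 := by
  have hm : Measurable (W.xi i) := (W.meas_xi i).mono (W.F.le _) le_rfl
  have m1 : MeasurableSet {ω | W.xi i ω = 1} := hm (measurableSet_singleton 1)
  have m2 : MeasurableSet {ω | W.xi i ω = -1} := hm (measurableSet_singleton (-1))
  have hd : Disjoint {ω | W.xi i ω = 1} {ω | W.xi i ω = -1} := by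
    rw [Set.disjoint_left]; intro ω h1 h2
    simp only [Set.mem_setOf_eq] at h1 h2
    linarith
  have h := measure_union (μ := μ) hd m2
  rw [W.xi_plus, W.xi_minus, ENNReal.add_halves] at h
  have := (prob_compl_eq_zero_iff (μ := μ) (m1.union m2)).2 h
  exact this

lemma zw_in (W : ZenoWalk μ lam eps del) (he : 0 < eps) (hd : del ≤ 1 / 2) (i : ℕ) :
    ∀ᵐ ω ∂μ, |W.Z i ω - lam| < eps := by
  induction i with
  | zero => filter_upwards [W.Z_zero] with ω h; simpa [h] using he
  | succ i ih =>
    filter_upwards [ih, W.step i, W.d_mem i, zw_xi_s5 W i] with ω h1 h2 h3 h4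
    have h5 : 0 < eps - |W.Z i ω - lam| := by linarith
    have h6 : 0 ≤ (eps - |W.Z i ω - lam|) * W.d i ω := mul_nonneg h5.le h3.1
    have h7 : (eps - |W.Z i ω - lam|) * W.d i ω ≤ (eps - |W.Z i ω - lam|) * (1/2) :=
      mul_le_mul_of_nonneg_left (h3.2.trans hd) h5.le
    have a1 := le_abs_self (W.Z i ω - lam)
    have a2 := neg_abs_le (W.Z i ω - lam)
    rw [h2, abs_lt]
    rcases h4 with h | h <;> rw [h] <;> constructor <;> linarith

lemma zw_half (W : ZenoWalk μ lam eps del) (i : ℕ) (c : ℝ)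
    (hc : μ {ω | W.xi i ω = c} = 1 / 2) (f : Ω → ENNReal) (hf : Measurable[W.F i] f) :
    ∫⁻ ω, ({ω | W.xi i ω = c}.indicator (fun _ => 1) ω) * f ω ∂μ = 1 / 2 * ∫⁻ ω, f ω ∂μ := by
  have hm : Measurable (W.xi i) := (W.meas_xi i).mono (W.F.le _) le_rfl
  have m1 : MeasurableSet {ω | W.xi i ω = c} := hm (measurableSet_singleton c)
  have m1' : MeasurableSet[MeasurableSpace.comap (W.xi i) inferInstance] {ω | W.xi i ω = c} :=
    ⟨{c}, measurableSet_singleton c, rfl⟩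
  rw [lintegral_mul_eq_lintegral_mul_lintegral_of_independent_measurableSpace
    hm.comap_le (W.F.le i) (W.xi_indep i)
    (@Measurable.indicator _ _ (_) _ _ _ _ (@measurable_const _ _ _ (_) 1) m1') hf]
  rw [lintegral_indicator m1]
  simp [hc]

lemma zw_step_s5 (W : ZenoWalk μ lam eps del) (he : 0 < eps) (hd0 : 0 < del) (hd : del ≤ 1 / 2)
    (i : ℕ) :
    ∫⁻ ω, ENNReal.ofReal (zwG lam eps (W.Z (i+1) ω)) ∂μ ≤
      ENNReal.ofReal (1 + 2 * del ^ 2) * ∫⁻ ω, ENNReal.ofReal (zwG lam eps (W.Z i ω)) ∂μ := by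
  set h : Ω → ℝ := fun ω => (eps - |W.Z i ω - lam|) * W.d i ω with hh
  have mZ := W.meas_Z i
  have md := W.meas_d i
  have mh : Measurable[W.F i] h :=
    (measurable_const.sub (continuous_abs.measurable.comp (mZ.sub measurable_const))).mul md
  have mp : Measurable[W.F i] (fun ω => ENNReal.ofReal (zwG lam eps (W.Z i ω + h ω))) :=
    ENNReal.measurable_ofReal.comp ((zwG_meas lam eps).comp (mZ.add mh))
  have mm : Measurable[W.F i] (fun ω => ENNReal.ofReal (zwG lam eps (W.Z i ω - h ω))) :=
    ENNReal.measurable_ofReal.comp ((zwG_meas lam eps).comp (mZ.sub mh))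
  have mx : Measurable (W.xi i) := (W.meas_xi i).mono (W.F.le _) le_rfl
  have m1 : MeasurableSet {ω | W.xi i ω = 1} := mx (measurableSet_singleton 1)
  calc ∫⁻ ω, ENNReal.ofReal (zwG lam eps (W.Z (i+1) ω)) ∂μ
      = ∫⁻ ω, (({ω | W.xi i ω = 1}.indicator (fun _ => 1) ω) *
            ENNReal.ofReal (zwG lam eps (W.Z i ω + h ω)) +
          ({ω | W.xi i ω = -1}.indicator (fun _ => 1) ω) *
            ENNReal.ofReal (zwG lam eps (W.Z i ω - h ω))) ∂μ := by
        apply lintegral_congr_ae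
        filter_upwards [W.step i, zw_xi_s5 W i] with ω h2 h4
        rw [h2]
        rcases h4 with h4 | h4
        · have : ¬ ((1:ℝ) = -1) := by norm_num
          simp [Set.indicator, h4, this, hh]
        · have : ¬ ((-1:ℝ) = 1) := by norm_num
          simp [Set.indicator, h4, this, hh, sub_eq_add_neg]
    _ = 1 / 2 * ∫⁻ ω, ENNReal.ofReal (zwG lam eps (W.Z i ω + h ω)) ∂μ +
        1 / 2 * ∫⁻ ω, ENNReal.ofReal (zwG lam eps (W.Z i ω - h ω)) ∂μ := by
        rw [lintegral_add_left, zw_half W i 1 (W.xi_plus i) _ mp,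
          zw_half W i (-1) (W.xi_minus i) _ mm]
        exact (measurable_const.indicator m1).mul (mp.mono (W.F.le i) le_rfl)
    _ = 1 / 2 * ∫⁻ ω, (ENNReal.ofReal (zwG lam eps (W.Z i ω + h ω)) +
          ENNReal.ofReal (zwG lam eps (W.Z i ω - h ω))) ∂μ := by
        rw [lintegral_add_left (mp.mono (W.F.le i) le_rfl), mul_add]
    _ ≤ 1 / 2 * ∫⁻ ω, (2 * ENNReal.ofReal (1 + 2 * del ^ 2)) *
          ENNReal.ofReal (zwG lam eps (W.Z i ω)) ∂μ := by
        gcongr 1 / 2 * ?_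
        apply lintegral_mono_ae
        filter_upwards [zw_in W he hd i, zw_in W he hd (i+1), W.d_mem i] with ω h1 _ h3
        have h5 : 0 < eps - |W.Z i ω - lam| := by linarith
        have h6 : 0 ≤ h ω := mul_nonneg h5.le h3.1
        have h8 : h ω ≤ del * (eps - |W.Z i ω - lam|) := by
          rw [mul_comm]; exact mul_le_mul_of_nonneg_left h3.2 h5.le
        have h7 : h ω ≤ (eps - |W.Z i ω - lam|) * (1/2) :=
          mul_le_mul_of_nonneg_left (h3.2.trans hd) h5.le
        have a1 := le_abs_self (W.Z i ω - lam)
        have a2 := neg_abs_le (W.Z i ω - lam)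
        rw [← ENNReal.ofReal_add
          (zwG_nonneg _ _ _ (by rw [abs_lt]; constructor <;> linarith))
          (zwG_nonneg _ _ _ (by rw [abs_lt]; constructor <;> linarith))]
        have e2 : (2 : ENNReal) = ENNReal.ofReal 2 := by simp
        rw [e2, ← ENNReal.ofReal_mul (by norm_num), ← ENNReal.ofReal_mul (by positivity)]
        exact ENNReal.ofReal_le_ofReal (zwG_step lam eps del _ _ h1 hd0 hd h6 h8)
    _ = _ := by
        rw [lintegral_const_mul' _ _ (by finiteness), ← mul_assoc, ← mul_assoc, one_div,
          ENNReal.inv_mul_cancel (by norm_num) (by norm_num), one_mul]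

lemma zw_bound (W : ZenoWalk μ lam eps del) (he : 0 < eps) (hd0 : 0 < del) (hd : del ≤ 1 / 2)
    (i : ℕ) :
    ∫⁻ ω, ENNReal.ofReal (zwG lam eps (W.Z i ω)) ∂μ ≤
      ENNReal.ofReal ((1 + 2 * del ^ 2) ^ i * (2 / eps)) := by
  induction i with
  | zero =>
    rw [lintegral_congr_ae (g := fun _ => ENNReal.ofReal (2 / eps))]
    · simp
    · filter_upwards [W.Z_zero] with ω h
      rw [h]; congr 1; unfold zwG; simp; ring
  | succ i ih =>
    refine (zw_step_s5 W he hd0 hd i).trans ?_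
    rw [pow_succ' _ i, mul_assoc, ENNReal.ofReal_mul (by positivity)]
    gcongr
end

theorem statement5 (a : ℝ) (ha : 0 < a) :
    ∃ C : ℝ, 0 < C ∧
      ∀ {Ω : Type} [mΩ : MeasurableSpace Ω] (μ : Measure Ω),
        IsProbabilityMeasure μ →
        ∀ lam eps : ℝ, 0 < eps →
        ∀ del : ℝ, del ∈ Set.Ioc (0 : ℝ) (1 / 2) →
        ∀ W : ZenoWalk μ lam eps del, ∀ l : ℕ, (l : ℝ) ≤ a / del ^ 2 →
        ∫⁻ ω, ENNReal.ofReal (1 / (eps - |W.Z l ω - lam|)) ∂μ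
          ≤ ENNReal.ofReal (C / eps) := by
  refine ⟨2 * Real.exp (2 * a), by positivity, ?_⟩
  intro Ω mΩ μ hμ lam eps he del hdel W l hl
  obtain ⟨hd0, hd⟩ := hdel
  calc _ ≤ ∫⁻ ω, ENNReal.ofReal (zwG lam eps (W.Z l ω)) ∂μ := by
        apply lintegral_mono_ae
        filter_upwards [zw_in W he hd l] with ω h
        exact ENNReal.ofReal_le_ofReal (zwG_ge _ _ _ h)
    _ ≤ _ := zw_bound W he hd0 hd l
    _ ≤ _ := by
        apply ENNReal.ofReal_le_ofReal
        have h1 : (1 + 2 * del ^ 2) ^ l ≤ Real.exp (2 * a) := by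
          calc (1 + 2 * del ^ 2) ^ l ≤ (Real.exp (2 * del ^ 2)) ^ l := by
                gcongr
                have := Real.add_one_le_exp (2 * del ^ 2)
                linarith
            _ = Real.exp (l * (2 * del ^ 2)) := by rw [← Real.exp_nat_mul]
            _ ≤ _ := by
                apply Real.exp_le_exp.2
                rw [le_div_iff₀ (by positivity)] at hl
                linarith
        calc _ ≤ Real.exp (2 * a) * (2 / eps) := by gcongr
          _ = _ := by ring
end

section
/- For every a > 0 there is a constant C = C(a) > 0 with the following property. Let λ ∈ ℝ, ε > 0, δ ∈ (0, 1/2], let T be a finite rooted binary tree in which every node has either zero or two children, and let (μ_v) be an assignment of real numbers to the nodes of T such that μ_root = λ and, for every internal node v with children u and w: μ_u + μ_w = 2·μ_v and |μ_u − μ_w| ≤ 2·δ·(ε − |μ_v − λ|). Then ε − |μ_v − λ| > 0 for every node v, and for every depth i with 0 ≤ i ≤ a/δ², the sum over all nodes v at depth i of 1/(ε − |μ_v − λ|) is at most C·2^i/ε. -/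
lemma key_aux (p d del : ℝ) (hp : 0 < p) (h0 : 0 < del) (h1 : del ≤ 1 / 2)
    (hd : |d| ≤ del * p) :
    1 / (p + d) + 1 / (p - d) ≤ 2 * (1 + 2 * del ^ 2) * (1 / p) := by
  obtain ⟨h2, h3⟩ := abs_le.mp hd
  have h4 : del * p ≤ p / 2 := by nlinarith
  have ha : 0 < p + d := by linarith
  have hb : 0 < p - d := by linarith
  have hsq : d ^ 2 ≤ del ^ 2 * p ^ 2 := by
    have := sq_le_sq' h2 h3
    nlinarith
  have hdel : del ^ 2 ≤ 1 / 4 := by nlinarith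
  have e : 1 / (p + d) + 1 / (p - d) = 2 * p / (p ^ 2 - d ^ 2) := by
    have : p ^ 2 - d ^ 2 ≠ 0 := by
      have : p ^ 2 - d ^ 2 = (p + d) * (p - d) := by ring
      rw [this]; positivity
    field_simp
    ring
  have hq : 0 < p ^ 2 - d ^ 2 := by nlinarith
  rw [e, mul_one_div, div_le_div_iff₀ hq hp]
  have h5 : (1 + 2 * del ^ 2) * d ^ 2 ≤ 2 * del ^ 2 * p ^ 2 := by
    calc (1 + 2 * del ^ 2) * d ^ 2 ≤ (1 + 2 * del ^ 2) * (del ^ 2 * p ^ 2) := by gcongr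
      _ = ((1 + 2 * del ^ 2) * (del ^ 2)) * p ^ 2 := by ring
      _ ≤ (2 * del ^ 2) * p ^ 2 := by
        gcongr
        nlinarith [sq_nonneg del]
  nlinarith

/-- Deterministic tree form of the Zeno-walk density bound.  A finite full binary
tree is encoded as a prefix-closed finite set of paths (`List Bool`), the root
being `[]`, the children of a node `l` being `true :: l` and `false :: l`, and
every node having zero or two children.  The depth of a node is its length. -/
theorem statement6 (a : ℝ) (ha : 0 < a) :
    ∃ C : ℝ, 0 < C ∧
      ∀ (lam eps del : ℝ), 0 < eps → del ∈ Set.Ioc (0 : ℝ) (1 / 2) →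
      ∀ nodes : Finset (List Bool),
        ([] ∈ nodes) →
        (∀ (b : Bool) (l : List Bool), b :: l ∈ nodes → l ∈ nodes) →
        (∀ l : List Bool, (true :: l ∈ nodes ↔ false :: l ∈ nodes)) →
      ∀ μ : List Bool → ℝ,
        μ [] = lam →
        (∀ l ∈ nodes, true :: l ∈ nodes →
          μ (true :: l) + μ (false :: l) = 2 * μ l ∧
          |μ (true :: l) - μ (false :: l)| ≤ 2 * del * (eps - |μ l - lam|)) →
      (∀ l ∈ nodes, 0 < eps - |μ l - lam|) ∧
      (∀ i : ℕ, (i : ℝ) ≤ a / del ^ 2 →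
        ∑ l ∈ nodes.filter (fun l => l.length = i), 1 / (eps - |μ l - lam|)
          ≤ C * 2 ^ i / eps) := by
  refine ⟨2 * Real.exp (2 * a), by positivity, ?_⟩
  rintro lam eps del heps ⟨hd0, hd1⟩ nodes hroot hpre hsib μ hμ hstep
  have hpos : ∀ l : List Bool, l ∈ nodes → 0 < eps - |μ l - lam| := by
    intro l
    induction l with
    | nil => intro _; simpa [hμ] using heps
    | cons b l ih =>
      intro hb
      have hl := hpre b l hb
      have ih := ih hl
      have ht : true :: l ∈ nodes := by
        cases b
        · exact (hsib l).2 hb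
        · exact hb
      obtain ⟨h1, h2⟩ := hstep l hl ht
      have h5 : del * (eps - |μ l - lam|) ≤ 1 / 2 * (eps - |μ l - lam|) := by gcongr
      obtain ⟨h3, h4⟩ := abs_le.mp h2
      have h6 := le_abs_self (μ l - lam)
      have h7 := neg_abs_le (μ l - lam)
      have : |μ (b :: l) - lam| < eps := by
        rw [abs_lt]
        cases b <;> constructor <;> linarith
      linarith
  refine ⟨hpos, ?_⟩
  set F : List Bool → ℝ := fun l => 1 / (eps - (μ l - lam)) + 1 / (eps + (μ l - lam)) with hF
  have hp1 : ∀ l ∈ nodes, 0 < eps - (μ l - lam) := fun l hl => by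
    have := hpos l hl
    have h6 := le_abs_self (μ l - lam)
    linarith
  have hp2 : ∀ l ∈ nodes, 0 < eps + (μ l - lam) := fun l hl => by
    have := hpos l hl
    have h6 := neg_abs_le (μ l - lam)
    linarith
  have hFpos : ∀ l ∈ nodes, 0 ≤ F l := fun l hl => by
    have := hp1 l hl
    have := hp2 l hl
    simp only [hF]
    positivity
  have hpair : ∀ l ∈ nodes, true :: l ∈ nodes →
      F (true :: l) + F (false :: l) ≤ 2 * (1 + 2 * del ^ 2) * F l := by
    intro l hl ht
    obtain ⟨h1, h2⟩ := hstep l hl ht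
    set d := (μ (true :: l) - μ (false :: l)) / 2 with hd
    have e1 : μ (true :: l) = μ l + d := by rw [hd]; linarith
    have e2 : μ (false :: l) = μ l - d := by rw [hd]; linarith
    have hda : |d| ≤ del * (eps - |μ l - lam|) := by
      rw [hd, abs_div, abs_of_pos (two_pos : (0:ℝ) < 2)]
      linarith
    have h6 := le_abs_self (μ l - lam)
    have h7 := neg_abs_le (μ l - lam)
    have k1 := key_aux (eps - (μ l - lam)) d del (hp1 l hl) hd0 hd1
      (hda.trans (by gcongr))
    have k2 := key_aux (eps + (μ l - lam)) d del (hp2 l hl) hd0 hd1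
      (hda.trans (by apply mul_le_mul_of_nonneg_left _ hd0.le; linarith))
    simp only [hF, e1, e2]
    rw [show eps - (μ l + d - lam) = eps - (μ l - lam) - d by ring,
      show eps - (μ l - d - lam) = eps - (μ l - lam) + d by ring,
      show eps + (μ l + d - lam) = eps + (μ l - lam) + d by ring,
      show eps + (μ l - d - lam) = eps + (μ l - lam) - d by ring]
    linarith
  have hsum : ∀ i : ℕ, ∑ l ∈ nodes.filter (fun l => l.length = i), F l
      ≤ (2 * (1 + 2 * del ^ 2)) ^ i * (2 / eps) := by
    intro i
    induction i with
    | zero =>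
      have : nodes.filter (fun l => l.length = 0) = {[]} := by
        ext l
        simp only [Finset.mem_filter, List.length_eq_zero_iff, Finset.mem_singleton]
        constructor
        · exact fun h => h.2
        · rintro rfl; exact ⟨hroot, rfl⟩
      rw [this, Finset.sum_singleton]
      simp only [hF, hμ, sub_self, sub_zero, add_zero, pow_zero, one_mul]
      apply le_of_eq
      ring
    | succ i ih =>
      have hmap : ∀ l ∈ nodes.filter (fun l => l.length = i + 1),
          l.tail ∈ nodes.filter (fun l => l.length = i) := by
        intro l hl
        rw [Finset.mem_filter] at hl ⊢
        cases l with
        | nil => simp at hl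
        | cons b l => exact ⟨hpre b l hl.1, by simpa using hl.2⟩
      rw [← Finset.sum_fiberwise_of_maps_to hmap]
      calc _ ≤ ∑ j ∈ nodes.filter (fun l => l.length = i), 2 * (1 + 2 * del ^ 2) * F j := by
            apply Finset.sum_le_sum
            intro j hj
            have hjn := (Finset.mem_filter.mp hj).1
            have hsub : ∀ l ∈ (nodes.filter (fun l => l.length = i + 1)).filter
                (fun l => l.tail = j), l ∈ nodes ∧ (l = true :: j ∨ l = false :: j) := by
              intro l hl
              simp only [Finset.mem_filter] at hl
              obtain ⟨⟨h1, h2⟩, h3⟩ := hl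
              refine ⟨h1, ?_⟩
              cases l with
              | nil => simp at h2
              | cons b l =>
                simp only [List.tail_cons] at h3
                subst h3
                cases b <;> simp
            by_cases ht : true :: j ∈ nodes
            · have hf := (hsib j).1 ht
              refine le_trans ?_ (hpair j hjn ht)
              rw [← Finset.sum_pair (show true :: j ≠ false :: j by simp)]
              apply Finset.sum_le_sum_of_subset_of_nonneg
              · intro l hl
                simpa using (hsub l hl).2
              · intro l hl _
                simp only [Finset.mem_insert, Finset.mem_singleton] at hl
                rcases hl with rfl | rfl
                · exact hFpos _ ht
                · exact hFpos _ hf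
            · have hf : false :: j ∉ nodes := fun h => ht ((hsib j).2 h)
              rw [Finset.sum_eq_zero]
              · have := hFpos j hjn
                positivity
              · intro l hl
                obtain ⟨h1, rfl | rfl⟩ := hsub l hl
                · exact absurd h1 ht
                · exact absurd h1 hf
        _ = 2 * (1 + 2 * del ^ 2) * ∑ j ∈ nodes.filter (fun l => l.length = i), F j := by
            rw [Finset.mul_sum]
        _ ≤ 2 * (1 + 2 * del ^ 2) * ((2 * (1 + 2 * del ^ 2)) ^ i * (2 / eps)) := by gcongr
        _ = _ := by ring
  intro i hi
  have hle : ∑ l ∈ nodes.filter (fun l => l.length = i), 1 / (eps - |μ l - lam|)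
      ≤ ∑ l ∈ nodes.filter (fun l => l.length = i), F l := by
    apply Finset.sum_le_sum
    intro l hl
    have hl := (Finset.mem_filter.mp hl).1
    have q1 := hp1 l hl
    have q2 := hp2 l hl
    have r1 : 0 < 1 / (eps - (μ l - lam)) := by positivity
    have r2 : 0 < 1 / (eps + (μ l - lam)) := by positivity
    simp only [hF]
    rcases abs_cases (μ l - lam) with ⟨h, _⟩ | ⟨h, _⟩
    · rw [h]; linarith
    · rw [h, sub_neg_eq_add]; linarith
  refine hle.trans ((hsum i).trans ?_)
  have hexp : (1 + 2 * del ^ 2) ^ i ≤ Real.exp (2 * a) := by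
    calc (1 + 2 * del ^ 2) ^ i ≤ (Real.exp (2 * del ^ 2)) ^ i := by
          gcongr
          linarith [Real.add_one_le_exp (2 * del ^ 2)]
      _ = Real.exp (i * (2 * del ^ 2)) := (Real.exp_nat_mul _ _).symm
      _ ≤ Real.exp (2 * a) := by
          apply Real.exp_le_exp.mpr
          rw [le_div_iff₀ (by positivity)] at hi
          linarith
  calc (2 * (1 + 2 * del ^ 2)) ^ i * (2 / eps)
      = (1 + 2 * del ^ 2) ^ i * (2 ^ i * (2 / eps)) := by rw [mul_pow]; ring
    _ ≤ Real.exp (2 * a) * (2 ^ i * (2 / eps)) := by gcongr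
    _ = _ := by ring
end

section
/- There is an absolute constant c₀ ≥ 1 and an absolute constant κ > 0 such that for every real c ≥ c₀, every integer m ≥ 16, every integer n ≤ m with ε := 1 − n/m satisfying 0 < ε ≤ 1/c, and every array configuration A on m slots with n elements: (1/m)·Σ_p φ(x_{p,1}) ≥ κ·Σ_{j ∈ J} Δ_j(A)², where the sum over p ranges over all m starting slots and x_{p,1} denotes the 1-block starting at slot p. -/
open scoped BigOperators Classical

/-- Read slot `i` (mod `m`) of a cyclic array of `m` boolean slots. -/
def cyc (m : ℕ) (A : Fin m → Bool) (i : ℕ) : Bool :=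
  if h : 0 < m then A ⟨i % m, Nat.mod_lt i h⟩ else false

/-- Number of occupied slots among the `j` cyclically consecutive slots
`p, p+1, …, p+j-1`. -/
def blockCount (m : ℕ) (A : Fin m → Bool) (p j : ℕ) : ℕ :=
  ((Finset.range j).filter (fun t => cyc m A (p + t) = true)).card

/-- Density of the `j`-block starting at slot `p`. -/
noncomputable def blockDensity (m : ℕ) (A : Fin m → Bool) (p j : ℕ) : ℝ :=
  (blockCount m A p j : ℝ) / j

/-- A block is live (w.r.t. constant `c` and sparsity `ε`) if its density is
at least `1 - c·ε`. -/
def IsLive (c ε : ℝ) (m : ℕ) (A : Fin m → Bool) (p j : ℕ) : Prop :=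
  1 - c * ε ≤ blockDensity m A p j

/-- Imbalance of a `j`-block (for even `j`): difference of the densities of its
two halves. -/
noncomputable def imbalance (m : ℕ) (A : Fin m → Bool) (p j : ℕ) : ℝ :=
  |blockDensity m A p (j / 2) - blockDensity m A (p + j / 2) (j / 2)|

/-- Adjusted imbalance: the imbalance if the block is live, `0` if it is dead. -/
noncomputable def adjImbalance (c ε : ℝ) (m : ℕ) (A : Fin m → Bool) (p j : ℕ) : ℝ :=
  if IsLive c ε m A p j then imbalance m A p j else 0

/-- `Δ_j(A)`: the average adjusted imbalance over all `m` `j`-blocks. -/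
noncomputable def DeltaAvg (c ε : ℝ) (m : ℕ) (A : Fin m → Bool) (j : ℕ) : ℝ :=
  (∑ p ∈ Finset.range m, adjImbalance c ε m A p j) / m

/-- `J = {2, 4, 8, …, 2^(⌊log₂ m⌋ - 2)}`. -/
def Jset (m : ℕ) : Finset ℕ := (Finset.Icc 1 (Nat.log 2 m - 2)).image (fun i => 2 ^ i)

/-- The potential `φ` of a `j`-block: `0` if dead, `(μ - (1 - c·ε))²` if live,
where `μ` is its density. -/
noncomputable def potential (c ε : ℝ) (m : ℕ) (A : Fin m → Bool) (p j : ℕ) : ℝ :=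
  if IsLive c ε m A p j then (blockDensity m A p j - (1 - c * ε)) ^ 2 else 0

theorem aux_cyc_per (m : ℕ) (A : Fin m → Bool) (i : ℕ) : cyc m A (i + m) = cyc m A i := by
  simp [cyc]

theorem aux_dens_per (m : ℕ) (A : Fin m → Bool) (p j : ℕ) :
    blockDensity m A (p + m) j = blockDensity m A p j := by
  have h : ∀ t, cyc m A (p + m + t) = cyc m A (p + t) := by
    intro t
    rw [show p + m + t = p + t + m by ring, aux_cyc_per]
  simp [blockDensity, blockCount, h]

theorem aux_shift (m : ℕ) (g : ℕ → ℝ) (hg : ∀ p, g (p + m) = g p) (h : ℕ) :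
    ∑ p ∈ Finset.range m, g (p + h) = ∑ p ∈ Finset.range m, g p := by
  induction h with
  | zero => simp
  | succ k ih =>
    rw [← ih]
    have h1 := Finset.sum_range_succ (fun p => g (p + k)) m
    have h2 := Finset.sum_range_succ' (fun p => g (p + k)) m
    have h3 : g (m + k) = g (0 + k) := by
      rw [show m + k = k + m by ring, hg, zero_add]
    have h4 : ∀ p, g (p + 1 + k) = g (p + (k + 1)) := fun p => by
      rw [show p + 1 + k = p + (k + 1) by ring]
    simp only [h4] at h2
    linarith

theorem aux_count (m : ℕ) (A : Fin m → Bool) (p j : ℕ) :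
    (blockCount m A p j : ℝ) = ∑ t ∈ Finset.range j, if cyc m A (p + t) = true then (1:ℝ) else 0 := by
  simp [blockCount]

theorem aux_half (m : ℕ) (A : Fin m → Bool) (p h : ℕ) :
    blockDensity m A p (2 * h) = (blockDensity m A p h + blockDensity m A (p + h) h) / 2 := by
  unfold blockDensity
  rw [aux_count, aux_count, aux_count, two_mul, Finset.sum_range_add]
  simp only [add_assoc]
  rcases Nat.eq_zero_or_pos h with rfl | hh
  · simp
  · have : (h : ℝ) ≠ 0 := by positivity
    push_cast
    field_simp
    ring

theorem aux_gain (θ a b : ℝ) :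
    (1 / 16) * (if θ ≤ (a + b) / 2 then |a - b| else 0) ^ 2
      + (if θ ≤ (a + b) / 2 then ((a + b) / 2 - θ) ^ 2 else 0)
      ≤ ((if θ ≤ a then (a - θ) ^ 2 else 0) + (if θ ≤ b then (b - θ) ^ 2 else 0)) / 2 := by
  split_ifs with h1 h2 h3 h3 h2 h3 h3
  · rw [sq_abs]; nlinarith [sq_nonneg (a - b)]
  · rw [sq_abs]; push Not at h3
    nlinarith [mul_nonneg (sub_nonneg.2 h2) (sub_nonneg.2 h3.le), sq_nonneg (a - b), sq_nonneg (a + b - 2 * θ),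
      mul_nonneg (sub_nonneg.2 h1) (sub_nonneg.2 h3.le), mul_nonneg (sub_nonneg.2 h1) (sub_nonneg.2 h2)]
  · rw [sq_abs]; push Not at h2
    nlinarith [mul_nonneg (sub_nonneg.2 h2.le) (sub_nonneg.2 h3), sq_nonneg (a - b), sq_nonneg (a + b - 2 * θ),
      mul_nonneg (sub_nonneg.2 h1) (sub_nonneg.2 h2.le), mul_nonneg (sub_nonneg.2 h1) (sub_nonneg.2 h3)]
  · linarith
  all_goals simp; try positivity

theorem aux_step (c ε : ℝ) (m : ℕ) (hm : 0 < m) (A : Fin m → Bool) (h : ℕ) :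
    (1 / 16) * (DeltaAvg c ε m A (2 * h)) ^ 2
      + (1 / m) * ∑ p ∈ Finset.range m, potential c ε m A p (2 * h)
      ≤ (1 / m) * ∑ p ∈ Finset.range m, potential c ε m A p h := by
  have hm' : (0 : ℝ) < m := by exact_mod_cast hm
  have hpt : ∀ p, (1 / 16) * (adjImbalance c ε m A p (2 * h)) ^ 2 + potential c ε m A p (2 * h)
      ≤ (potential c ε m A p h + potential c ε m A (p + h) h) / 2 := by
    intro p
    have := aux_gain (1 - c * ε) (blockDensity m A p h) (blockDensity m A (p + h) h)
    simp only [adjImbalance, potential, IsLive, imbalance, aux_half,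
      Nat.mul_div_cancel_left h (two_pos)]
    convert this using 3 <;> congr
  have hs := Finset.sum_le_sum (s := Finset.range m) (fun p _ => hpt p)
  rw [Finset.sum_add_distrib, ← Finset.mul_sum, ← Finset.sum_div, Finset.sum_add_distrib,
    aux_shift m (fun p => potential c ε m A p h)
      (fun p => by simp only [potential, IsLive, aux_dens_per]; congr)] at hs
  have hcs := sq_sum_le_card_mul_sum_sq (s := Finset.range m)
    (f := fun p => adjImbalance c ε m A p (2 * h))
  rw [Finset.card_range] at hcs
  have hd : (DeltaAvg c ε m A (2 * h)) ^ 2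
      ≤ (1 / m) * ∑ p ∈ Finset.range m, (adjImbalance c ε m A p (2 * h)) ^ 2 := by
    unfold DeltaAvg
    rw [div_pow, div_le_iff₀ (by positivity)]
    calc _ ≤ _ := hcs
      _ = _ := by field_simp
  have := mul_le_mul_of_nonneg_left hs (show (0:ℝ) ≤ 1 / m by positivity)
  nlinarith

theorem aux_tele (c ε : ℝ) (m : ℕ) (hm : 0 < m) (A : Fin m → Bool) (k : ℕ) :
    (1 / 16) * ∑ i ∈ Finset.Icc 1 k, (DeltaAvg c ε m A (2 ^ i)) ^ 2
      + (1 / m) * ∑ p ∈ Finset.range m, potential c ε m A p (2 ^ k)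
      ≤ (1 / m) * ∑ p ∈ Finset.range m, potential c ε m A p 1 := by
  induction k with
  | zero => simp
  | succ k ih =>
    rw [Finset.sum_Icc_succ_top (by omega)]
    have := aux_step c ε m hm A (2 ^ k)
    rw [← pow_succ'] at this
    linarith

theorem statement9 :
    ∃ c₀ : ℝ, 1 ≤ c₀ ∧ ∃ κ : ℝ, 0 < κ ∧
      ∀ c : ℝ, c₀ ≤ c →
      ∀ m : ℕ, 16 ≤ m → ∀ n : ℕ, n ≤ m →
      0 < 1 - (n : ℝ) / m → 1 - (n : ℝ) / m ≤ 1 / c →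
      ∀ A : Fin m → Bool, (Finset.univ.filter (fun i => A i = true)).card = n →
      κ * ∑ j ∈ Jset m, (DeltaAvg c (1 - (n : ℝ) / m) m A j) ^ 2
        ≤ (1 / m) * ∑ p ∈ Finset.range m, potential c (1 - (n : ℝ) / m) m A p 1 := by
  refine ⟨1, le_refl _, 1 / 16, by norm_num, ?_⟩
  intro c _ m hm n _ _ _ A _
  have h := aux_tele c (1 - (n : ℝ) / m) m (by omega) A (Nat.log 2 m - 2)
  have h0 : 0 ≤ (1 / (m : ℝ)) * ∑ p ∈ Finset.range m,
      potential c (1 - (n : ℝ) / m) m A p (2 ^ (Nat.log 2 m - 2)) := by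
    refine mul_nonneg (by positivity) (Finset.sum_nonneg fun p _ => ?_)
    unfold potential
    split_ifs <;> positivity
  unfold Jset
  rw [Finset.sum_image (fun a _ b _ hab => Nat.pow_right_injective (le_refl 2) hab)]
  linarith
end

section
/- There is an absolute constant c₀ ≥ 10 such that for every real c ≥ c₀ the following holds. Let m be a sufficiently large integer and let n = (1 − ε)·m be an integer with m^{−1/3} ≤ ε ≤ 1/c. Fix any history-independent insertion/deletion model at size n on m slots, and let j ∈ J and let s be an integer with j/6 ≤ s ≤ j/3. Draw t uniform in {⌈n/4⌉ − s, …, ⌊n/2⌋ − s}, start from A ∼ 𝒞_n, and perform k := ⌊c·j·Δ_j⌋ + 1 insertion/deletion pairs, where each pair applies an insertion at rank t + s followed by a deletion at rank n+1 to the current configuration. Before each operation, let x denote the j-block starting at the position of the current rank-t element. Then with probability at least 0.6, at least one of the 2k operations is critical to x. -/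
open scoped BigOperators Classical

/-- An array configuration on `m` slots with `k` elements: a boolean occupancy
vector with exactly `k` occupied slots. -/
abbrev Config (m k : ℕ) :=
  {A : Fin m → Bool // (Finset.univ.filter (fun i => A i = true)).card = k}

/-- Expectation of a real-valued function under a probability mass function on a
finite type. -/
noncomputable def pexp {α : Type*} [Fintype α] (p : PMF α) (f : α → ℝ) : ℝ :=
  ∑ a, (p a).toReal * f a

/-- Probability of an event under a probability mass function on a finite type. -/
noncomputable def pprob {α : Type*} [Fintype α] (p : PMF α) (E : α → Prop) : ℝ :=
  pexp p (fun a => if E a then 1 else 0)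

/-- `posOf A s` is the position (0-indexed slot) of the rank-`s` element of `A`,
i.e. the `s`-th smallest occupied slot (`s` is 1-indexed). -/
def posOf {m : ℕ} (A : Fin m → Bool) (s : ℕ) : ℕ :=
  (((List.range m).filter (fun i => cyc m A i))).getD (s - 1) 0

/-- A history-independent insertion/deletion model at size `n` on `m` slots:
distributions `C0` (on `n`-element configurations) and `C1` (on `(n+1)`-element
configurations), insertion couplings `ins r` for each rank `r ∈ {1, …, n+1}`,
and a deletion coupling `del` for rank `n+1`, all with marginals `C0` and `C1`. -/
structure HIModel (m n : ℕ) where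
  C0 : PMF (Config m n)
  C1 : PMF (Config m (n + 1))
  ins : ℕ → PMF (Config m n × Config m (n + 1))
  del : PMF (Config m n × Config m (n + 1))
  ins_fst : ∀ r, 1 ≤ r → r ≤ n + 1 → PMF.map Prod.fst (ins r) = C0
  ins_snd : ∀ r, 1 ≤ r → r ≤ n + 1 → PMF.map Prod.snd (ins r) = C1
  del_fst : PMF.map Prod.fst del = C0
  del_snd : PMF.map Prod.snd del = C1

/-- The coupling `p` conditioned on its first coordinate being `A` (junk value
`p` itself when the conditioning event is null; such states are reached with
probability zero). -/
noncomputable def condFst {m n : ℕ} (p : PMF (Config m n × Config m (n + 1)))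
    (A : Config m n) : PMF (Config m n × Config m (n + 1)) :=
  if h : ∃ q ∈ {q : Config m n × Config m (n + 1) | q.1 = A}, q ∈ p.support then
    p.filter {q | q.1 = A} h
  else p

/-- The coupling `p` conditioned on its second coordinate being `A'`. -/
noncomputable def condSnd {m n : ℕ} (p : PMF (Config m n × Config m (n + 1)))
    (A' : Config m (n + 1)) : PMF (Config m n × Config m (n + 1)) :=
  if h : ∃ q ∈ {q : Config m n × Config m (n + 1) | q.2 = A'}, q ∈ p.support then
    p.filter {q | q.2 = A'} h
  else p

/-- Rank of an old element after an insertion at rank `r`. -/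
def insShift (r s : ℕ) : ℕ := if s < r then s else s + 1

/-- The (cyclic) slots of the 1st, `(j/2)`-th and `j`-th positions of the
`j`-block starting at slot `p`: the slots of the boundary set `B(x)`. -/
def boundarySlots (m p j : ℕ) : Finset ℕ :=
  {p % m, (p + j / 2 - 1) % m, (p + j - 1) % m}

/-- An insertion at rank `r` realized by the pair `(A0, A1)` is critical to the
`j`-block of `A0` starting at slot `p`: the block is live in `A0` and some
element of its boundary set is rearranged. -/
def InsCritical (c : ℝ) (m n r j p : ℕ) (A0 : Config m n) (A1 : Config m (n + 1)) : Prop :=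
  IsLive c (1 - (n : ℝ) / m) m A0.1 p j ∧
  ∃ s ∈ Finset.Icc 1 n, posOf A0.1 s ∈ boundarySlots m p j ∧
    posOf A0.1 s ≠ posOf A1.1 (insShift r s)

/-- A deletion at rank `n+1` realized by the pair `(A0, A1)` (`A1` before, `A0`
after) is critical to the `j`-block of `A1` starting at slot `p`. -/
def DelCritical (c : ℝ) (m n j p : ℕ) (A0 : Config m n) (A1 : Config m (n + 1)) : Prop :=
  IsLive c (1 - ((n : ℝ) + 1) / m) m A1.1 p j ∧
  ∃ s ∈ Finset.Icc 1 n, posOf A1.1 s ∈ boundarySlots m p j ∧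
    posOf A1.1 s ≠ posOf A0.1 s

/-- Probability that, starting from configuration `A` and performing `k`
insertion/deletion pairs (insertion at rank `r`, deletion at rank `n+1`),
no operation is critical to the `j`-block starting at the position of the
current rank-`t` element (in the configuration just before that operation). -/
noncomputable def probNoCrit (c : ℝ) {m n : ℕ} (Mo : HIModel m n) (t r j : ℕ) :
    ℕ → Config m n → ℝ
  | 0, _ => 1
  | k + 1, A =>
      pexp (condFst (Mo.ins r) A) fun q =>
        if InsCritical c m n r j (posOf q.1.1 t) q.1 q.2 then 0
        else pexp (condSnd Mo.del q.2) fun q' =>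
          if DelCritical c m n j (posOf q'.2.1 t) q'.1 q'.2 then 0
          else probNoCrit c Mo t r j k q'.1

/-- `Δ_j` for the stationary distribution `C0` of a model. -/
noncomputable def DeltaExp (c : ℝ) {m n : ℕ} (Mo : HIModel m n) (j : ℕ) : ℝ :=
  pexp Mo.C0 (fun A => DeltaAvg c (1 - (n : ℝ) / m) m A.1 j)


def occ {m : ℕ} (A : Fin m → Bool) (i : ℕ) : Prop := i < m ∧ cyc m A i = true

lemma occ_fin {m : ℕ} (A : Fin m → Bool) : (Set.ofPred (occ A)).Finite :=
  (Set.finite_lt_nat m).subset (fun _ hx => hx.1)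

lemma occ_toFinset {m : ℕ} (A : Fin m → Bool) :
    (occ_fin A).toFinset = ((List.range m).filter (fun i => cyc m A i)).toFinset := by
  ext x
  rw [Set.Finite.mem_toFinset]
  simp only [List.mem_toFinset, List.mem_filter, List.mem_range]
  rfl

lemma posOf_eq_nth {m : ℕ} (A : Fin m → Bool) (s : ℕ) :
    posOf A s = Nat.nth (occ A) (s - 1) := by
  rw [Nat.nth_eq_getD_sort (occ_fin A), occ_toFinset, posOf]
  congr 1
  symm
  refine (List.toFinset_sort _ ?_).2 ?_
  · exact List.Nodup.filter _ List.nodup_range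
  · exact (List.pairwise_le_range).filter _

lemma occ_filter {m : ℕ} (A : Fin m → Bool) :
    (Finset.range m).filter (fun i => cyc m A i = true) =
      (Finset.univ.filter (fun i => A i = true)).map Fin.valEmbedding := by
  ext x
  simp only [Finset.mem_filter, Finset.mem_range, Finset.mem_map, Finset.mem_univ, true_and,
    Fin.valEmbedding_apply]
  constructor
  · rintro ⟨h1, h2⟩
    refine ⟨⟨x, h1⟩, ?_, rfl⟩
    have h0 : 0 < m := by omega
    simpa [cyc, h0, Nat.mod_eq_of_lt h1] using h2
  · rintro ⟨a, ha, rfl⟩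
    have h0 : 0 < m := a.pos
    refine ⟨a.2, ?_⟩
    simpa [cyc, h0, Nat.mod_eq_of_lt a.2] using ha

lemma occ_card {m k : ℕ} (A : Config m k) : (occ_fin A.1).toFinset.card = k := by
  have h : (occ_fin A.1).toFinset = (Finset.range m).filter (fun i => cyc m A.1 i = true) := by
    ext x
    rw [Set.Finite.mem_toFinset]
    simp only [Finset.mem_filter, Finset.mem_range]
    rfl
  rw [h, occ_filter, Finset.card_map, A.2]

lemma count_total {m k : ℕ} (A : Config m k) : Nat.count (fun i => cyc m A.1 i = true) m = k := by
  rw [Nat.count_eq_card_filter_range, occ_filter, Finset.card_map, A.2]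

lemma count_occ {m : ℕ} (A : Fin m → Bool) (x : ℕ) (hx : x ≤ m) :
    Nat.count (occ A) x = Nat.count (fun i => cyc m A i = true) x := by
  rw [Nat.count_eq_card_filter_range, Nat.count_eq_card_filter_range]
  congr 1
  apply Finset.filter_congr
  intro y hy
  have := Finset.mem_range.1 hy
  simp only [occ]
  constructor
  · exact fun h => h.2
  · exact fun h => ⟨by omega, h⟩

lemma posOf_spec {m k : ℕ} (A : Config m k) (s : ℕ) (h1 : 1 ≤ s) (h2 : s ≤ k) :
    posOf A.1 s < m ∧ cyc m A.1 (posOf A.1 s) = true ∧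
      Nat.count (fun i => cyc m A.1 i = true) (posOf A.1 s) + 1 = s := by
  have hc : ∀ hf : (Set.ofPred (occ A.1)).Finite, s - 1 < hf.toFinset.card := by
    intro hf
    have := occ_card A
    have e : hf.toFinset.card = (occ_fin A.1).toFinset.card := rfl
    omega
  have hm := Nat.nth_mem (s - 1) hc
  have hn := Nat.count_nth hc
  rw [← posOf_eq_nth] at hm hn
  refine ⟨hm.1, hm.2, ?_⟩
  rw [count_occ _ _ hm.1.le] at hn
  omega

lemma posOf_count {m : ℕ} (A : Fin m → Bool) (x : ℕ) (hx : x < m) (h : cyc m A x = true) :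
    posOf A (Nat.count (fun i => cyc m A i = true) x + 1) = x := by
  rw [posOf_eq_nth, ← count_occ A x hx.le]
  exact Nat.nth_count (p := occ A) ⟨hx, h⟩

lemma posOf_injOn {m k : ℕ} (A : Config m k) : Set.InjOn (posOf A.1) (Set.Icc 1 k) := by
  intro a ha b hb hab
  have h1 := (posOf_spec A a ha.1 ha.2).2.2
  have h2 := (posOf_spec A b hb.1 hb.2).2.2
  rw [hab] at h1
  omega

lemma blockCount_count {m : ℕ} (A : Fin m → Bool) (p j : ℕ) :
    Nat.count (fun i => cyc m A i = true) (p + j) =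
      Nat.count (fun i => cyc m A i = true) p + blockCount m A p j := by
  rw [Nat.count_add, blockCount, Nat.count_eq_card_filter_range (fun k => cyc m A (p + k) = true)]

/-- positions upper bound -/
lemma posOf_le {m k : ℕ} (A : Config m k) (s : ℕ) (h1 : 1 ≤ s) (h2 : s ≤ k) :
    posOf A.1 s + k + 1 ≤ s + m := by
  obtain ⟨a, b, c⟩ := posOf_spec A s h1 h2
  have h := blockCount_count A.1 (posOf A.1 s) (m - posOf A.1 s)
  have h' : blockCount m A.1 (posOf A.1 s) (m - posOf A.1 s) ≤ m - posOf A.1 s := by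
    unfold blockCount
    exact (Finset.card_filter_le _ _).trans (by simp)
  rw [Nat.add_sub_cancel' a.le, count_total] at h
  omega

/-- State of a block: ranks of its three boundary elements. -/
def St {m k : ℕ} (B : Config m k) (t p h L R : ℕ) : Prop :=
  posOf B.1 t = p ∧ posOf B.1 (t + L - 1) = p + h - 1 ∧ posOf B.1 (t + L + R - 1) = p + 2 * h - 1

lemma St_counts {m k : ℕ} (B : Config m k) (t p h L R : ℕ) (hS : St B t p h L R)
    (ht : 1 ≤ t) (hL : 1 ≤ L) (hh : 1 ≤ h) (hk : t + L + R - 1 ≤ k) :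
    blockCount m B.1 p h = L ∧ blockCount m B.1 (p + h) h = R ∧
      blockCount m B.1 p (2 * h) = L + R ∧ t + L + R - 1 ≤ p + 2 * h := by
  obtain ⟨h1, h2, h3⟩ := hS
  have a1 := posOf_spec B t ht (by omega)
  have a2 := posOf_spec B (t + L - 1) (by omega) (by omega)
  have a3 := posOf_spec B (t + L + R - 1) (by omega) (by omega)
  rw [h1] at a1
  rw [h2] at a2
  rw [h3] at a3
  have b1 := blockCount_count B.1 p h
  have b2 := blockCount_count B.1 (p + h) h
  have b3 := blockCount_count B.1 p (2 * h)
  have e : p + h + h = p + 2 * h := by omega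
  rw [e] at b2
  have c2 := Nat.count_succ (fun i => cyc m B.1 i = true) (p + h - 1)
  have c3 := Nat.count_succ (fun i => cyc m B.1 i = true) (p + 2 * h - 1)
  rw [if_pos a2.2.1, show p + h - 1 + 1 = p + h by omega] at c2
  rw [if_pos a3.2.1, show p + 2 * h - 1 + 1 = p + 2 * h by omega] at c3
  have d := Nat.count_le (p := fun i => cyc m B.1 i = true) (n := p + 2 * h)
  refine ⟨by omega, by omega, by omega, by omega⟩

lemma St_init {m k : ℕ} (B : Config m k) (t h : ℕ) (ht : 1 ≤ t) (htk : t ≤ k) (hh : 1 ≤ h)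
    (hm : posOf B.1 t + 2 * h ≤ m)
    (o1 : cyc m B.1 (posOf B.1 t + h - 1) = true)
    (o2 : cyc m B.1 (posOf B.1 t + 2 * h - 1) = true) :
    St B t (posOf B.1 t) h (blockCount m B.1 (posOf B.1 t) h)
      (blockCount m B.1 (posOf B.1 t + h) h) := by
  have a1 := posOf_spec B t ht htk
  set p := posOf B.1 t with hp
  have b1 := blockCount_count B.1 p h
  have b2 := blockCount_count B.1 (p + h) h
  have e : p + h + h = p + 2 * h := by omega
  rw [e] at b2
  have c2 := Nat.count_succ (fun i => cyc m B.1 i = true) (p + h - 1)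
  have c3 := Nat.count_succ (fun i => cyc m B.1 i = true) (p + 2 * h - 1)
  rw [if_pos o1, show p + h - 1 + 1 = p + h by omega] at c2
  rw [if_pos o2, show p + 2 * h - 1 + 1 = p + 2 * h by omega] at c3
  have d1 := posOf_count B.1 (p + h - 1) (by omega) o1
  have d2 := posOf_count B.1 (p + 2 * h - 1) (by omega) o2
  refine ⟨rfl, ?_, ?_⟩
  · rw [← c2, b1] at d1
    rw [← d1]
    congr 1
    omega
  · rw [← c3, b2, b1] at d2
    rw [← d2]
    congr 1
    omega

lemma St_ins {c : ℝ} {m n t s h p L R : ℕ} (A0 : Config m n) (A1 : Config m (n + 1))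
    (hS : St A0 t p h L R) (ht : 1 ≤ t) (hs : 1 ≤ s) (hL : s + 1 ≤ L) (hh : 1 ≤ h)
    (hk : t + L + R - 1 ≤ n) (hpn : p + 2 * h ≤ n) (hnm : n ≤ m)
    (hlive : 1 - c * (1 - (n : ℝ) / m) ≤ ((L : ℝ) + R) / (2 * h : ℕ))
    (hnc : ¬ InsCritical c m n (t + s) (2 * h) (posOf A0.1 t) A0 A1) :
    St A1 t p h (L + 1) R ∧ t + (L + 1) + R - 1 ≤ n := by
  have hc := St_counts A0 t p h L R hS ht (by omega) hh hk
  obtain ⟨h1, h2, h3⟩ := hS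
  have hlv : IsLive c (1 - (n : ℝ) / m) m A0.1 (posOf A0.1 t) (2 * h) := by
    unfold IsLive blockDensity
    rw [h1, hc.2.2.1]
    push_cast at hlive ⊢
    exact hlive
  have key : ∀ q ∈ Finset.Icc 1 n, posOf A0.1 q ∈ boundarySlots m (posOf A0.1 t) (2 * h) →
      posOf A1.1 (insShift (t + s) q) = posOf A0.1 q := by
    intro q hq hq2
    by_contra hne
    exact hnc ⟨hlv, q, hq, hq2, fun e => hne e.symm⟩
  have e1 : 2 * h / 2 = h := by omega
  have k1 := key t (by simp; omega) (by
    simp only [boundarySlots, h1, Finset.mem_insert]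
    left; rw [Nat.mod_eq_of_lt]; omega)
  have k2 := key (t + L - 1) (by simp; omega) (by
    simp only [boundarySlots, h1, h2, Finset.mem_insert, e1]
    right; left; rw [Nat.mod_eq_of_lt]; omega)
  have k3 := key (t + L + R - 1) (by simp; omega) (by
    simp only [boundarySlots, h1, h3, Finset.mem_insert, e1, Finset.mem_singleton]
    right; right; rw [Nat.mod_eq_of_lt]; omega)
  unfold insShift at k1 k2 k3
  rw [if_pos (by omega)] at k1
  rw [if_neg (by omega)] at k2
  rw [if_neg (by omega)] at k3
  have hS' : St A1 t p h (L + 1) R := by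
    refine ⟨k1.trans h1, ?_, ?_⟩
    · rw [← h2, ← k2]; congr 1; omega
    · rw [← h3, ← k3]; congr 1; omega
  refine ⟨hS', ?_⟩
  have := St_counts A1 t p h (L + 1) R hS' ht (by omega) hh (by omega)
  omega

lemma St_del {c : ℝ} {m n t h p L R : ℕ} (A0 : Config m n) (A1 : Config m (n + 1))
    (hS : St A1 t p h L R) (ht : 1 ≤ t) (hL : 1 ≤ L) (hh : 1 ≤ h)
    (hk : t + L + R - 1 ≤ n) (hpn : p + 2 * h ≤ n) (hnm : n ≤ m)
    (hlive : 1 - c * (1 - ((n : ℝ) + 1) / m) ≤ ((L : ℝ) + R) / (2 * h : ℕ))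
    (hnc : ¬ DelCritical c m n (2 * h) (posOf A1.1 t) A0 A1) :
    St A0 t p h L R := by
  have hc := St_counts A1 t p h L R hS ht (by omega) hh (by omega)
  obtain ⟨h1, h2, h3⟩ := hS
  have hlv : IsLive c (1 - ((n : ℝ) + 1) / m) m A1.1 (posOf A1.1 t) (2 * h) := by
    unfold IsLive blockDensity
    rw [h1, hc.2.2.1]
    push_cast at hlive ⊢
    exact hlive
  have key : ∀ q ∈ Finset.Icc 1 n, posOf A1.1 q ∈ boundarySlots m (posOf A1.1 t) (2 * h) →
      posOf A0.1 q = posOf A1.1 q := by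
    intro q hq hq2
    by_contra hne
    exact hnc ⟨hlv, q, hq, hq2, fun e => hne e.symm⟩
  have e1 : 2 * h / 2 = h := by omega
  have k1 := key t (by simp; omega) (by
    simp only [boundarySlots, h1, Finset.mem_insert]
    left; rw [Nat.mod_eq_of_lt]; omega)
  have k2 := key (t + L - 1) (by simp; omega) (by
    simp only [boundarySlots, h1, h2, Finset.mem_insert, e1]
    right; left; rw [Nat.mod_eq_of_lt]; omega)
  have k3 := key (t + L + R - 1) (by simp; omega) (by
    simp only [boundarySlots, h1, h3, Finset.mem_insert, e1, Finset.mem_singleton]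
    right; right; rw [Nat.mod_eq_of_lt]; omega)
  exact ⟨k1.trans h1, k2.trans h2, k3.trans h3⟩

section pexpLemmas
variable {α β : Type*} [Fintype α] [Fintype β]

lemma pexp_mono (p : PMF α) (f g : α → ℝ) (h : ∀ a, p a ≠ 0 → f a ≤ g a) :
    pexp p f ≤ pexp p g := by
  unfold pexp
  apply Finset.sum_le_sum
  intro a _
  by_cases ha : p a = 0
  · simp [ha]
  · exact mul_le_mul_of_nonneg_left (h a ha) ENNReal.toReal_nonneg

lemma pexp_add (p : PMF α) (f g : α → ℝ) :
    pexp p (fun a => f a + g a) = pexp p f + pexp p g := by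
  simp [pexp, mul_add, Finset.sum_add_distrib]

lemma pexp_const_mul (p : PMF α) (b : ℝ) (f : α → ℝ) :
    pexp p (fun a => b * f a) = b * pexp p f := by
  simp only [pexp, Finset.mul_sum]
  exact Finset.sum_congr rfl fun a _ => by ring

lemma pmf_sum (p : PMF α) : ∑ a, (p a).toReal = 1 := by
  rw [← ENNReal.toReal_sum (fun a _ => p.apply_ne_top a), ← tsum_fintype (L := .unconditional α),
    p.tsum_coe]
  rfl

lemma pexp_const (p : PMF α) (b : ℝ) : pexp p (fun _ => b) = b := by
  simp [pexp, ← Finset.sum_mul, pmf_sum]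

lemma pexp_sum {ι : Type*} (p : PMF α) (S : Finset ι) (f : ι → α → ℝ) :
    ∑ i ∈ S, pexp p (f i) = pexp p (fun a => ∑ i ∈ S, f i a) := by
  simp only [pexp, Finset.mul_sum]
  exact Finset.sum_comm

lemma pmf_map_toReal (p : PMF α) (φ : α → β) (b : β) :
    ((PMF.map φ p) b).toReal = ∑ a, if φ a = b then (p a).toReal else 0 := by
  rw [PMF.map_apply, tsum_fintype, ENNReal.toReal_sum]
  · refine Finset.sum_congr rfl fun a _ => ?_
    by_cases h : φ a = b
    · simp [h]
    · simp [h, Ne.symm h]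
  · intro a _
    split_ifs
    · exact p.apply_ne_top a
    · simp

lemma pexp_map (p : PMF α) (φ : α → β) (f : β → ℝ) :
    pexp (PMF.map φ p) f = pexp p (fun a => f (φ a)) := by
  simp only [pexp, pmf_map_toReal, Finset.sum_mul]
  rw [Finset.sum_comm]
  refine Finset.sum_congr rfl fun a _ => ?_
  simp [ite_mul]

/-- generic conditioning -/
lemma pexp_filter (p : PMF α) (φ : α → β) (b : β) (f : α → ℝ)
    (h : ∃ q ∈ {q | φ q = b}, q ∈ p.support) :
    ((PMF.map φ p) b).toReal * pexp (p.filter {q | φ q = b} h) f =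
      ∑ a, if φ a = b then (p a).toReal * f a else 0 := by
  have hb : ∑' a', ({q | φ q = b} : Set α).indicator p a' = (PMF.map φ p) b := by
    rw [PMF.map_apply]
    refine tsum_congr fun a => ?_
    by_cases h : φ a = b
    · simp [Set.indicator, h]
    · simp [Set.indicator, h, Ne.symm h]
  have hb0 : ((PMF.map φ p) b).toReal ≠ 0 := by
    refine ENNReal.toReal_ne_zero.2 ⟨?_, PMF.apply_ne_top _ _⟩
    obtain ⟨q, hq, hq2⟩ := h
    exact (PMF.mem_support_iff _ _).1 ((PMF.mem_support_map_iff _ _ _).2 ⟨q, hq2, hq⟩)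
  simp only [pexp, PMF.filter_apply, hb, Finset.mul_sum]
  refine Finset.sum_congr rfl fun a _ => ?_
  by_cases h : φ a = b
  · simp only [Set.indicator, Set.mem_ofPred_eq, h, if_true, ENNReal.toReal_mul, ENNReal.toReal_inv]
    field_simp
  · simp [Set.indicator, h]

lemma pexp_cond (p : PMF α) (φ : α → β) (C : β → PMF α)
    (hC : ∀ b (h : ∃ q ∈ {q | φ q = b}, q ∈ p.support), C b = p.filter {q | φ q = b} h)
    (f : α → ℝ) :
    pexp (PMF.map φ p) (fun b => pexp (C b) f) = pexp p f := by
  have key : ∀ b, ((PMF.map φ p) b).toReal * pexp (C b) f =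
      ∑ a, if φ a = b then (p a).toReal * f a else 0 := by
    intro b
    by_cases h : ∃ q ∈ {q | φ q = b}, q ∈ p.support
    · rw [hC b h, pexp_filter]
    · have hz : ∀ a, φ a = b → p a = 0 := by
        intro a ha
        by_contra hne
        exact h ⟨a, ha, (PMF.mem_support_iff _ _).2 hne⟩
      rw [pmf_map_toReal]
      have e1 : ∀ a, (if φ a = b then (p a).toReal else 0) = 0 := by
        intro a
        split_ifs with ha
        · simp [hz a ha]
        · rfl
      have e2 : ∀ a, (if φ a = b then (p a).toReal * f a else 0) = 0 := by
        intro a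
        split_ifs with ha
        · simp [hz a ha]
        · rfl
      simp [e1, e2]
  unfold pexp at *
  rw [Finset.sum_congr rfl fun b _ => key b, Finset.sum_comm]
  simp

end pexpLemmas

lemma condFst_avg {m n : ℕ} (p : PMF (Config m n × Config m (n + 1)))
    (f : Config m n × Config m (n + 1) → ℝ) :
    pexp (PMF.map Prod.fst p) (fun A => pexp (condFst p A) f) = pexp p f := by
  apply pexp_cond p Prod.fst
  intro b h
  unfold condFst
  rw [dif_pos h]

lemma condSnd_avg {m n : ℕ} (p : PMF (Config m n × Config m (n + 1)))
    (f : Config m n × Config m (n + 1) → ℝ) :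
    pexp (PMF.map Prod.snd p) (fun A => pexp (condSnd p A) f) = pexp p f := by
  apply pexp_cond p Prod.snd
  intro b h
  unfold condSnd
  rw [dif_pos h]

lemma condFst_supp {m n : ℕ} (p : PMF (Config m n × Config m (n + 1))) (A : Config m n)
    (hA : (PMF.map Prod.fst p) A ≠ 0) (q) (hq : condFst p A q ≠ 0) :
    q.1 = A ∧ (PMF.map Prod.snd p) q.2 ≠ 0 := by
  obtain ⟨a, ha, hh⟩ := (PMF.mem_support_map_iff _ _ _).1 ((PMF.mem_support_iff _ _).2 hA)
  have h : ∃ q ∈ {q : Config m n × Config m (n + 1) | q.1 = A}, q ∈ p.support := ⟨a, hh, ha⟩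
  unfold condFst at hq
  rw [dif_pos h] at hq
  have := (PMF.mem_support_filter_iff _).1 ((PMF.mem_support_iff _ _).2 hq)
  exact ⟨this.1, (PMF.mem_support_iff _ _).1 ((PMF.mem_support_map_iff _ _ _).2 ⟨q, this.2, rfl⟩)⟩

lemma condSnd_supp {m n : ℕ} (p : PMF (Config m n × Config m (n + 1))) (A : Config m (n + 1))
    (hA : (PMF.map Prod.snd p) A ≠ 0) (q) (hq : condSnd p A q ≠ 0) :
    q.2 = A ∧ (PMF.map Prod.fst p) q.1 ≠ 0 := by
  obtain ⟨a, ha, hh⟩ := (PMF.mem_support_map_iff _ _ _).1 ((PMF.mem_support_iff _ _).2 hA)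
  have h : ∃ q ∈ {q : Config m n × Config m (n + 1) | q.2 = A}, q ∈ p.support := ⟨a, hh, ha⟩
  unfold condSnd at hq
  rw [dif_pos h] at hq
  have := (PMF.mem_support_filter_iff _).1 ((PMF.mem_support_iff _ _).2 hq)
  exact ⟨this.1, (PMF.mem_support_iff _ _).1 ((PMF.mem_support_map_iff _ _ _).2 ⟨q, this.2, rfl⟩)⟩

noncomputable def iterE {m n : ℕ} (Mo : HIModel m n) (r : ℕ) (f : Config m n → ℝ) :
    ℕ → Config m n → ℝ
  | 0, A => f A
  | k + 1, A => pexp (condFst (Mo.ins r) A) fun q =>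
      pexp (condSnd Mo.del q.2) fun q' => iterE Mo r f k q'.1

lemma iterE_nonneg {m n : ℕ} (Mo : HIModel m n) (r : ℕ) (f : Config m n → ℝ) (hf : ∀ A, 0 ≤ f A)
    (k : ℕ) : ∀ A, 0 ≤ iterE Mo r f k A := by
  induction k with
  | zero => exact hf
  | succ k ih =>
    intro A
    unfold iterE
    rw [← pexp_const (condFst (Mo.ins r) A) 0]
    apply pexp_mono
    intro q _
    rw [← pexp_const (condSnd Mo.del q.2) 0]
    apply pexp_mono
    intro q' _
    exact ih _

lemma iterE_affine {m n : ℕ} (Mo : HIModel m n) (r : ℕ) (f : Config m n → ℝ) (a b : ℝ)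
    (k : ℕ) : ∀ A, iterE Mo r (fun B => a + b * f B) k A = a + b * iterE Mo r f k A := by
  induction k with
  | zero => intro A; rfl
  | succ k ih =>
    intro A
    simp only [iterE, ih, pexp_add, pexp_const_mul, pexp_const]

lemma iterE_stat {m n : ℕ} (Mo : HIModel m n) (r : ℕ) (h1 : 1 ≤ r) (h2 : r ≤ n + 1)
    (f : Config m n → ℝ) (k : ℕ) : pexp Mo.C0 (iterE Mo r f k) = pexp Mo.C0 f := by
  induction k with
  | zero => rfl
  | succ k ih =>
    rw [← ih]
    have e1 := condFst_avg (Mo.ins r) (fun q =>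
      pexp (condSnd Mo.del q.2) fun q' => iterE Mo r f k q'.1)
    rw [Mo.ins_fst r h1 h2] at e1
    have e2 := pexp_map (Mo.ins r) Prod.snd (fun q =>
      pexp (condSnd Mo.del q) fun q' => iterE Mo r f k q'.1)
    rw [Mo.ins_snd r h1 h2] at e2
    have e3 := condSnd_avg Mo.del (fun q' => iterE Mo r f k q'.1)
    rw [Mo.del_snd] at e3
    have e4 := pexp_map Mo.del Prod.fst (iterE Mo r f k)
    rw [Mo.del_fst] at e4
    have e0 : iterE Mo r f (k + 1) = fun A => pexp (condFst (Mo.ins r) A) fun q =>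
      pexp (condSnd Mo.del q.2) fun q' => iterE Mo r f k q'.1 := rfl
    rw [e0, e1, ← e2, e3, e4]

lemma probNoCrit_bounds {c : ℝ} {m n : ℕ} (Mo : HIModel m n) (t r j k : ℕ) :
    ∀ A, probNoCrit c Mo t r j k A ≤ 1 := by
  induction k with
  | zero => intro A; exact le_rfl
  | succ k ih =>
    intro A
    unfold probNoCrit
    refine (pexp_mono _ _ (fun _ => 1) ?_).trans (pexp_const _ _).le
    intro q _
    split_ifs
    · norm_num
    · refine (pexp_mono _ _ (fun _ => 1) ?_).trans (pexp_const _ _).le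
      intro q' _
      split_ifs
      · norm_num
      · exact ih _

lemma main_ind {c : ℝ} {m n t s h p R : ℕ} (Mo : HIModel m n) (ht : 1 ≤ t) (hs : 1 ≤ s)
    (htn : t + s ≤ n + 1) (hc : 0 ≤ c)
    (hh : 1 ≤ h) (hpn : p + 2 * h ≤ n) (hnm : n ≤ m) (f : Config m n → ℝ) (hf : ∀ B, 0 ≤ f B)
    (k : ℕ) : ∀ (L : ℕ) (A : Config m n), Mo.C0 A ≠ 0 → s + 1 ≤ L →
    1 - c * (1 - ((n : ℝ) + 1) / m) ≤ ((L : ℝ) + R) / (2 * h : ℕ) →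
    St A t p h L R → t + L + R - 1 ≤ n →
    (∀ B : Config m n, St B t p h (L + k) R → t + (L + k) + R - 1 ≤ n → 1 ≤ f B) →
    probNoCrit c Mo t (t + s) (2 * h) k A ≤ iterE Mo (t + s) f k A := by
  induction k with
  | zero =>
    intro L A _ _ _ hS hn hB
    exact hB A hS hn
  | succ k ih =>
    intro L A hA hL hlive hS hn hB
    unfold probNoCrit iterE
    apply pexp_mono
    intro q hq
    have hq1 := condFst_supp (Mo.ins (t + s)) A
      (by rw [Mo.ins_fst _ (by omega) htn]; exact hA) q hq
    rw [Mo.ins_snd _ (by omega) htn, ← Mo.del_snd] at hq1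
    obtain ⟨hqA, hq2⟩ := hq1
    split_ifs with hcr
    · rw [← pexp_const (condSnd Mo.del q.2) 0]
      exact pexp_mono _ _ _ fun q' _ => iterE_nonneg _ _ _ hf _ _
    · have hl0 : 1 - c * (1 - (n : ℝ) / m) ≤ ((L : ℝ) + R) / (2 * h : ℕ) := by
        refine le_trans ?_ hlive
        have : (n : ℝ) / m ≤ ((n : ℝ) + 1) / m := by gcongr; linarith
        nlinarith
      obtain ⟨hS1, hn1⟩ := St_ins (c := c) q.1 q.2 (hqA ▸ hS) ht hs hL hh hn hpn hnm hl0 hcr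
      have hlive' : 1 - c * (1 - ((n : ℝ) + 1) / m) ≤ (((L + 1 : ℕ) : ℝ) + R) / (2 * h : ℕ) := by
        refine hlive.trans ?_
        push_cast
        gcongr
        linarith
      apply pexp_mono
      intro q' hq'
      obtain ⟨hqA', hq2'⟩ := condSnd_supp Mo.del q.2 hq2 q' hq'
      rw [Mo.del_fst] at hq2'
      split_ifs with hcr'
      · exact iterE_nonneg _ _ _ hf _ _
      · have hS2 := St_del (c := c) q'.1 q'.2 (hqA'.symm ▸ hS1) ht (by omega) hh hn1 hpn hnm
          hlive' hcr'
        apply ih (L + 1) q'.1 hq2' (by omega) hlive' hS2 hn1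
        intro B hSB hnB
        apply hB B
        · rwa [show L + (k + 1) = L + 1 + k by omega]
        · omega

noncomputable def emp (m : ℕ) (A : Fin m → Bool) (x : ℕ) : ℝ := if cyc m A x = true then 0 else 1

lemma emp_nonneg (m : ℕ) (A : Fin m → Bool) (x : ℕ) : 0 ≤ emp m A x := by
  unfold emp; split_ifs <;> norm_num

lemma emp_sum_block (m : ℕ) (A : Fin m → Bool) (p j : ℕ) :
    ∑ i ∈ Finset.range j, emp m A (p + i) = j - blockCount m A p j := by
  have h : ∀ i, emp m A (p + i) = 1 - (if cyc m A (p + i) = true then (1 : ℝ) else 0) := by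
    intro i; unfold emp; split_ifs <;> norm_num
  simp only [h, Finset.sum_sub_distrib, Finset.sum_const, Finset.card_range, nsmul_eq_mul, mul_one]
  rw [blockCount, Finset.card_filter]
  push_cast
  rfl

lemma cyc_periodic (m : ℕ) (A : Fin m → Bool) :
    Function.Periodic (fun i => cyc m A i = true) m := by
  intro x
  simp [cyc]

lemma emp_sum_shift {m n : ℕ} (A : Config m n) (i : ℕ) :
    ∑ p ∈ Finset.range m, emp m A.1 (p + i) = (m : ℝ) - n := by
  have h1 := emp_sum_block m A.1 i m
  have h2 := Nat.filter_Ico_card_eq_of_periodic i m _ (cyc_periodic m A.1)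
  rw [count_total] at h2
  have h4 : blockCount m A.1 i m = n := by
    refine Eq.trans ?_ h2
    unfold blockCount
    refine Finset.card_bij (fun a _ => i + a) ?_ ?_ ?_
    · intro a ha
      simp only [Finset.mem_filter, Finset.mem_range, Finset.mem_Ico] at ha ⊢
      exact ⟨by omega, ha.2⟩
    · intro a _ b _ hab
      omega
    · intro b hb
      simp only [Finset.mem_filter, Finset.mem_range, Finset.mem_Ico] at hb
      refine ⟨b - i, ?_, by omega⟩
      simp only [Finset.mem_filter, Finset.mem_range]
      rw [show i + (b - i) = b by omega]
      exact ⟨by omega, hb.2⟩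
  rw [h4] at h1
  rw [← h1]
  exact Finset.sum_congr rfl fun p _ => by rw [add_comm]

lemma sum_pos_le {m n : ℕ} (A : Config m n) (S : Finset ℕ) (hS : ∀ t ∈ S, 1 ≤ t ∧ t ≤ n)
    (f : ℕ → ℝ) (hf : ∀ x, 0 ≤ f x) :
    ∑ t ∈ S, f (posOf A.1 t) ≤ ∑ p ∈ Finset.range m, f p := by
  rw [← Finset.sum_image (f := f) (g := posOf A.1)]
  · apply Finset.sum_le_sum_of_subset_of_nonneg
    · intro x hx
      obtain ⟨t, ht, rfl⟩ := Finset.mem_image.1 hx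
      exact Finset.mem_range.2 (posOf_spec A t (hS t ht).1 (hS t ht).2).1
    · intro x _ _
      exact hf x
  · intro a ha b hb hab
    exact posOf_injOn A (hS a ha) (hS b hb) hab

lemma adj_nonneg (c ε : ℝ) (m : ℕ) (A : Fin m → Bool) (p j : ℕ) :
    0 ≤ adjImbalance c ε m A p j := by
  unfold adjImbalance imbalance
  split_ifs
  · exact abs_nonneg _
  · exact le_rfl

lemma adj_St {c ε : ℝ} {m n t p h L R : ℕ} (B : Config m n) (hS : St B t p h L R)
    (ht : 1 ≤ t) (hL : 1 ≤ L) (hh : 1 ≤ h) (hk : t + L + R - 1 ≤ n)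
    (hlive : 1 - c * ε ≤ ((L : ℝ) + R) / (2 * h : ℕ)) :
    adjImbalance c ε m B.1 (posOf B.1 t) (2 * h) = |(L : ℝ) / h - (R : ℝ) / h| := by
  obtain ⟨h1, h2, h3, h4⟩ := St_counts B t p h L R hS ht hL hh hk
  have e1 : 2 * h / 2 = h := by omega
  unfold adjImbalance
  rw [hS.1, if_pos]
  · unfold imbalance blockDensity
    rw [e1, h1, h2]
  · unfold IsLive blockDensity
    rw [h3]
    push_cast at hlive ⊢
    exact hlive

lemma per_t {c ε : ℝ} {m n t s h k : ℕ} (Mo : HIModel m n) (A : Config m n) (hA : Mo.C0 A ≠ 0)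
    (ht : 1 ≤ t) (hs : 1 ≤ s) (htn : t + s ≤ n) (hc : 0 < c) (hh : 1 ≤ h)
    (hpn : posOf A.1 t + 2 * h ≤ n) (hnm : n ≤ m) (hk : 1 ≤ k) (hs3 : 3 * s ≤ 2 * h)
    (hε : ε = 1 - (n : ℝ) / m) (hε0 : 0 < ε) (hεm : 2 ≤ ε * m) :
    probNoCrit c Mo t (t + s) (2 * h) k A ≤
      emp m A.1 (posOf A.1 t + (h - 1)) + emp m A.1 (posOf A.1 t + (2 * h - 1)) +
      (10 / h + 1 / (c * ε * h)) * ∑ i ∈ Finset.range (2 * h), emp m A.1 (posOf A.1 t + i) +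
      ((h / k : ℝ) * adjImbalance c ε m A.1 (posOf A.1 t) (2 * h) +
       (h / k : ℝ) * iterE Mo (t + s) (fun B => adjImbalance c ε m B.1 (posOf B.1 t) (2 * h)) k A) := by
  have hhR : (1 : ℝ) ≤ h := by exact_mod_cast hh
  have hkR : (1 : ℝ) ≤ k := by exact_mod_cast hk
  have hP := probNoCrit_bounds (c := c) Mo t (t + s) (2 * h) k A
  have n1 := emp_nonneg m A.1 (posOf A.1 t + (h - 1))
  have n2 := emp_nonneg m A.1 (posOf A.1 t + (2 * h - 1))
  have hE0 : 0 ≤ ∑ i ∈ Finset.range (2 * h), emp m A.1 (posOf A.1 t + i) :=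
    Finset.sum_nonneg fun i _ => emp_nonneg _ _ _
  have hEq := emp_sum_block m A.1 (posOf A.1 t) (2 * h)
  set E := ∑ i ∈ Finset.range (2 * h), emp m A.1 (posOf A.1 t + i) with hE
  have n3 : 0 ≤ 10 / (h : ℝ) * E := by positivity
  have n4 : 0 ≤ 1 / (c * ε * h) * E := by positivity
  have n5 : 0 ≤ (h / k : ℝ) * adjImbalance c ε m A.1 (posOf A.1 t) (2 * h) :=
    mul_nonneg (by positivity) (adj_nonneg _ _ _ _ _ _)
  have n6 : 0 ≤ (h / k : ℝ) *
      iterE Mo (t + s) (fun B => adjImbalance c ε m B.1 (posOf B.1 t) (2 * h)) k A :=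
    mul_nonneg (by positivity) (iterE_nonneg _ _ _ (fun B => adj_nonneg _ _ _ _ _ _) _ _)
  rw [add_mul]
  by_cases o1 : cyc m A.1 (posOf A.1 t + (h - 1)) = true
  swap
  · have : emp m A.1 (posOf A.1 t + (h - 1)) = 1 := by simp [emp, o1]
    linarith
  by_cases o2 : cyc m A.1 (posOf A.1 t + (2 * h - 1)) = true
  swap
  · have : emp m A.1 (posOf A.1 t + (2 * h - 1)) = 1 := by simp [emp, o2]
    linarith
  by_cases o3 : (h : ℝ) < 10 * E
  · have : 1 ≤ 10 / (h : ℝ) * E := by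
      rw [div_mul_eq_mul_div, le_div_iff₀ (by positivity)]
      linarith
    linarith
  by_cases o4 : c * ε * h < E
  · have : 1 ≤ 1 / (c * ε * h) * E := by
      rw [div_mul_eq_mul_div, le_div_iff₀ (by positivity)]
      linarith
    linarith
  push Not at o3 o4
  have hS := St_init A t h ht (by omega) hh (by omega)
    (by rwa [show posOf A.1 t + h - 1 = posOf A.1 t + (h - 1) by omega])
    (by rwa [show posOf A.1 t + 2 * h - 1 = posOf A.1 t + (2 * h - 1) by omega])
  set p := posOf A.1 t with hp
  set L := blockCount m A.1 p h with hL
  set R := blockCount m A.1 (p + h) h with hR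
  have hRle : R ≤ h := by
    rw [hR]; unfold blockCount
    exact (Finset.card_filter_le _ _).trans (by simp)
  have hLR : blockCount m A.1 p (2 * h) = L + R := by
    have b1 := blockCount_count A.1 p h
    have b2 := blockCount_count A.1 (p + h) h
    have b3 := blockCount_count A.1 p (2 * h)
    rw [show p + h + h = p + 2 * h by omega] at b2
    omega
  rw [hLR] at hEq
  push_cast at hEq
  have hRleR : (R : ℝ) ≤ h := by exact_mod_cast hRle
  have hs3R : 3 * (s : ℝ) ≤ 2 * h := by exact_mod_cast hs3
  have hsL : s + 1 ≤ L := by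
    have : (s : ℝ) < L := by linarith
    exact_mod_cast this
  have hmpos : (0 : ℝ) < m := by
    rcases Nat.eq_zero_or_pos m with h0 | h0
    · subst h0; simp at hεm; linarith
    · exact_mod_cast h0
  have hlive : 1 - c * (1 - ((n : ℝ) + 1) / m) ≤ ((L : ℝ) + R) / (2 * h : ℕ) := by
    rw [le_div_iff₀ (by push_cast; positivity)]
    push_cast
    have e : 1 - ((n : ℝ) + 1) / m = ε - 1 / m := by rw [hε]; ring
    have e2 : 1 / (m : ℝ) ≤ ε / 2 := by
      rw [div_le_iff₀ hmpos]; linarith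
    rw [e]
    have : c * (ε / 2) * (2 * h) ≤ c * (ε - 1 / m) * (2 * h) := by
      gcongr; linarith
    nlinarith
  have hnk : t + L + R - 1 ≤ n := by
    have b2 := blockCount_count A.1 p (2 * h)
    have b := (posOf_spec A t ht (by omega)).2.2
    have d := Nat.count_le (p := fun i => cyc m A.1 i = true) (n := p + 2 * h)
    rw [← hp] at b
    omega
  have hl0 : 1 - c * ε ≤ ((L : ℝ) + R) / (2 * h : ℕ) := by
    refine le_trans ?_ hlive
    have : (n : ℝ) / m ≤ ((n : ℝ) + 1) / m := by gcongr; linarith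
    rw [hε]
    nlinarith
  have adjA := adj_St (c := c) (ε := ε) A hS ht (by omega) hh hnk hl0
  have := main_ind (c := c) (R := R) Mo ht hs (by omega) hc.le hh hpn hnm
    (fun B => (h / k : ℝ) * adjImbalance c ε m A.1 p (2 * h) +
       (h / k : ℝ) * (fun B : Config m n => adjImbalance c ε m B.1 (posOf B.1 t) (2 * h)) B)
    (fun B => by
      have := adj_nonneg c ε m B.1 (posOf B.1 t) (2 * h)
      have h0 : (0 : ℝ) ≤ h / k := by positivity
      exact add_nonneg n5 (mul_nonneg h0 this)) k L A hA hsL hlive hS hnk (by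
      intro B hSB hnB
      have adjB := adj_St (c := c) (ε := ε) B hSB ht (by omega) hh hnB (hl0.trans (by
        push_cast
        gcongr
        linarith))
      rw [← hp] at adjA
      simp only [adjA, adjB]
      have hk0 : (0 : ℝ) < k := by linarith
      have hh0 : (0 : ℝ) < h := by linarith
      rw [← mul_add, div_mul_eq_mul_div, le_div_iff₀ hk0, one_mul]
      have a1 := neg_abs_le ((L : ℝ) / h - (R : ℝ) / h)
      have a2 := le_abs_self (((L + k : ℕ) : ℝ) / h - (R : ℝ) / h)
      have a3 : (k : ℝ) / h = (((L + k : ℕ) : ℝ) / h - (R : ℝ) / h) - ((L : ℝ) / h - (R : ℝ) / h) := by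
        push_cast; ring
      have a4 : (k : ℝ) = h * (k / h) := by field_simp
      calc (k : ℝ) = h * (k / h) := a4
        _ ≤ _ := by
          apply mul_le_mul_of_nonneg_left _ hh0.le
          rw [a3]; linarith)
  rw [iterE_affine] at this
  linarith

lemma sum_bound {c ε : ℝ} {m n s h k : ℕ} (Mo : HIModel m n) (S : Finset ℕ)
    (hS : ∀ t ∈ S, 1 ≤ t ∧ t + s ≤ n / 2)
    (hs : 1 ≤ s) (hc : 0 < c) (hh : 1 ≤ h)
    (h8 : 8 * h ≤ m) (hnm : n ≤ m) (h56 : 5 * m ≤ 6 * n)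
    (hk : 1 ≤ k) (hs3 : 3 * s ≤ 2 * h)
    (hε : ε = 1 - (n : ℝ) / m) (hε0 : 0 < ε) (hεm : 2 ≤ ε * m) :
    ∑ t ∈ S, pexp Mo.C0 (fun A => probNoCrit c Mo t (t + s) (2 * h) k A) ≤
      ((m : ℝ) - n) + ((m : ℝ) - n) +
        (10 / h + 1 / (c * ε * h)) * ((2 * h : ℕ) * ((m : ℝ) - n)) +
      2 * (h / k : ℝ) * (m * DeltaExp c Mo (2 * h)) := by
  set w : ℝ := 10 / h + 1 / (c * ε * h) with hw
  have hw0 : 0 ≤ w := by positivity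
  let G : ℕ → Config m n → ℝ := fun t A =>
    emp m A.1 (posOf A.1 t + (h - 1)) + emp m A.1 (posOf A.1 t + (2 * h - 1)) +
      w * ∑ i ∈ Finset.range (2 * h), emp m A.1 (posOf A.1 t + i)
  let D : ℕ → Config m n → ℝ := fun t A => adjImbalance c ε m A.1 (posOf A.1 t) (2 * h)
  have h1 : ∀ t ∈ S, pexp Mo.C0 (fun A => probNoCrit c Mo t (t + s) (2 * h) k A) ≤
      pexp Mo.C0 (G t) + 2 * (h / k : ℝ) * pexp Mo.C0 (D t) := by
    intro t ht
    obtain ⟨ht1, ht2⟩ := hS t ht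
    have e : pexp Mo.C0 (fun A => G t A +
        ((h / k : ℝ) * D t A + (h / k : ℝ) * iterE Mo (t + s) (D t) k A)) =
        pexp Mo.C0 (G t) + 2 * (h / k : ℝ) * pexp Mo.C0 (D t) := by
      rw [pexp_add _ (G t), pexp_add _ (fun A => (h / k : ℝ) * D t A), pexp_const_mul _ _ (D t),
        pexp_const_mul]
      have := iterE_stat Mo (t + s) (by omega) (by omega) (D t) k
      change pexp Mo.C0 (fun A => iterE Mo (t + s) (D t) k A) = _ at this
      rw [this]
      ring
    rw [← e]
    apply pexp_mono
    intro A hA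
    have hp := posOf_le A t ht1 (by omega)
    exact per_t Mo A hA ht1 hs (by omega) hc hh (by omega) hnm hk hs3 hε hε0 hεm
  refine (Finset.sum_le_sum h1).trans ?_
  rw [Finset.sum_add_distrib, ← Finset.mul_sum, pexp_sum, pexp_sum]
  have hS' : ∀ t ∈ S, 1 ≤ t ∧ t ≤ n := fun t ht => by
    have := hS t ht
    omega
  apply add_le_add
  · refine (pexp_mono _ _ (fun _ => _) ?_).trans (pexp_const _ _).le
    intro A _
    simp only [G, Finset.sum_add_distrib, ← Finset.mul_sum]
    have b : ∀ i, ∑ t ∈ S, emp m A.1 (posOf A.1 t + i) ≤ (m : ℝ) - n := by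
      intro i
      rw [← emp_sum_shift A i]
      exact sum_pos_le A S hS' (fun x => emp m A.1 (x + i)) (fun x => emp_nonneg _ _ _)
    refine add_le_add (add_le_add (b _) (b _)) ?_
    apply mul_le_mul_of_nonneg_left _ hw0
    rw [Finset.sum_comm]
    refine (Finset.sum_le_sum fun i _ => b i).trans ?_
    rw [Finset.sum_const, Finset.card_range, nsmul_eq_mul]
  · apply mul_le_mul_of_nonneg_left _ (by positivity)
    unfold DeltaExp
    rw [← pexp_const_mul]
    apply pexp_mono
    intro A _
    refine (sum_pos_le A S hS' (fun x => adjImbalance c ε m A.1 x (2 * h))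
      (fun x => adj_nonneg _ _ _ _ _ _)).trans ?_
    unfold DeltaAvg
    rw [← hε]
    have hmpos : (m : ℝ) ≠ 0 := by
      have : 0 < m := by omega
      positivity
    rw [mul_div_cancel₀ _ hmpos]

theorem statement13 :
    ∃ c₀ : ℝ, 10 ≤ c₀ ∧
      ∀ c : ℝ, c₀ ≤ c → ∃ M : ℕ, ∀ m : ℕ, M ≤ m →
      ∀ n : ℕ, n ≤ m →
      ((m : ℝ) ^ (-(1 : ℝ) / 3) ≤ 1 - (n : ℝ) / m) → (1 - (n : ℝ) / m ≤ 1 / c) →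
      ∀ Mo : HIModel m n, ∀ j ∈ Jset m, ∀ s : ℕ,
      ((j : ℝ) / 6 ≤ s) → ((s : ℝ) ≤ (j : ℝ) / 3) →
      (0.6 : ℝ) ≤ 1 -
        (1 / ((Finset.Icc ((n + 3) / 4 - s) (n / 2 - s)).card : ℝ)) *
          ∑ t ∈ Finset.Icc ((n + 3) / 4 - s) (n / 2 - s),
            pexp Mo.C0 (fun A =>
              probNoCrit c Mo t (t + s) j (⌊c * j * DeltaExp c Mo j⌋₊ + 1) A) := by
  refine ⟨1000, by norm_num, ?_⟩
  intro c hc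
  refine ⟨1000, ?_⟩
  intro m hm n hnm he1 he2 Mo j hj s hs1 hs2
  obtain ⟨i, hi, rfl⟩ := Finset.mem_image.1 hj
  rw [Finset.mem_Icc] at hi
  obtain ⟨h, hh, hhj, h8⟩ : ∃ h : ℕ, 1 ≤ h ∧ 2 ^ i = 2 * h ∧ 8 * h ≤ m := by
    obtain ⟨i', rfl⟩ : ∃ i', i = i' + 1 := ⟨i - 1, by omega⟩
    refine ⟨2 ^ i', Nat.one_le_two_pow, by ring, ?_⟩
    have h1 : 2 ^ (i' + 3) ≤ 2 ^ Nat.log 2 m := Nat.pow_le_pow_right (by norm_num) (by omega)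
    have h2 := Nat.pow_log_le_self 2 (show m ≠ 0 by omega)
    have h3 : 2 ^ (i' + 3) = 8 * 2 ^ i' := by ring
    omega
  beta_reduce at hs1 hs2 ⊢
  rw [hhj] at hs1 hs2 ⊢
  clear hj hi hhj i
  have hmR : (1000 : ℝ) ≤ m := by exact_mod_cast hm
  have hm0 : (0 : ℝ) < m := by linarith
  have hc0 : (0 : ℝ) < c := by linarith
  set ε : ℝ := 1 - (n : ℝ) / m with hε
  have hεmn : ε * m = (m : ℝ) - n := by rw [hε]; field_simp
  have hlt : 1 / (m : ℝ) < ε := by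
    refine lt_of_lt_of_le ?_ he1
    rw [one_div, ← Real.rpow_neg_one]
    exact Real.rpow_lt_rpow_of_exponent_lt (by linarith) (by norm_num)
  have hε0 : 0 < ε := lt_trans (by positivity) hlt
  have hεm : 2 ≤ ε * m := by
    rw [div_lt_iff₀ hm0, hεmn] at hlt
    have : n + 1 < m := by
      have : (n : ℝ) + 1 < m := by linarith
      exact_mod_cast this
    have : n + 2 ≤ m := by omega
    have : (n : ℝ) + 2 ≤ m := by exact_mod_cast this
    linarith
  have hce : c * ε ≤ 1 := by
    rw [le_div_iff₀ hc0] at he2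
    linarith
  have hεle : ε ≤ 1 / 1000 := by
    refine he2.trans ?_
    exact one_div_le_one_div_of_le (by norm_num) hc
  have hn1 : 999 * m ≤ 1000 * n := by
    have : 999 * (m : ℝ) ≤ 1000 * n := by nlinarith
    exact_mod_cast this
  have hs3 : 3 * s ≤ 2 * h := by
    have : 3 * (s : ℝ) ≤ 2 * h := by push_cast at hs2; linarith
    exact_mod_cast this
  have hs0 : 1 ≤ s := by
    have hhR : (1 : ℝ) ≤ h := by exact_mod_cast hh
    have : 0 < (s : ℝ) := by push_cast at hs1; linarith
    exact_mod_cast this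
  set Δ := DeltaExp c Mo (2 * h) with hΔ
  set k := ⌊c * ((2 * h : ℕ) : ℝ) * Δ⌋₊ + 1 with hk
  have hkgt : c * ((2 * h : ℕ) : ℝ) * Δ < k := by
    rw [hk]; push_cast
    exact Nat.lt_floor_add_one _
  have hk1 : 1 ≤ k := by omega
  have hsum := sum_bound (c := c) (ε := ε) (k := k) Mo
    (Finset.Icc ((n + 3) / 4 - s) (n / 2 - s)) (fun t ht => by
      rw [Finset.mem_Icc] at ht
      omega) hs0 hc0 hh h8 hnm (by omega) hk1 hs3 hε hε0 hεm
  set X := ∑ t ∈ Finset.Icc ((n + 3) / 4 - s) (n / 2 - s),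
    pexp Mo.C0 (fun A => probNoCrit c Mo t (t + s) (2 * h) k A) with hX
  have hcard : m ≤ 5 * (Finset.Icc ((n + 3) / 4 - s) (n / 2 - s)).card := by
    rw [Nat.card_Icc]
    omega
  set T := (Finset.Icc ((n + 3) / 4 - s) (n / 2 - s)).card with hT
  have hTR : (m : ℝ) ≤ 5 * T := by exact_mod_cast hcard
  have hT0 : (0 : ℝ) < T := by linarith
  have hhR : (1 : ℝ) ≤ h := by exact_mod_cast hh
  have hkR : (1 : ℝ) ≤ k := by exact_mod_cast hk1
  have hXm : X ≤ m / 40 := by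
    refine hsum.trans ?_
    rw [← hεmn]
    have e1 : (10 / (h : ℝ) + 1 / (c * ε * h)) * (((2 * h : ℕ) : ℝ) * (ε * m)) =
        20 * (ε * m) + 2 * m * (1 / c) := by
      push_cast
      field_simp
      ring
    have e2 : 2 * ((h : ℝ) / k) * (m * Δ) ≤ m * (1 / c) := by
      have : 2 * ((h : ℝ) / k) * (m * Δ) = m * ((2 * h * Δ) / k) := by ring
      rw [this]
      apply mul_le_mul_of_nonneg_left _ hm0.le
      rw [div_le_div_iff₀ (by linarith) hc0]
      push_cast at hkgt
      linarith
    have e3 : 1 / c ≤ 1 / 1000 := one_div_le_one_div_of_le (by norm_num) hc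
    have e4 : ε * m ≤ 1 / 1000 * m := by gcongr
    have e5 : m * (1 / c) ≤ m * (1 / 1000) := by gcongr
    rw [e1]
    linarith
  have : 1 / (T : ℝ) * X ≤ 0.4 := by
    rw [div_mul_eq_mul_div, div_le_iff₀ hT0]
    linarith
  linarith
end
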